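/- arXiv:2109.11184 — 2 statements merged into one kernel-verified Lean document; each statement's English description precedes it below -/
import Mathlib

section
/- Let K = ℚ(√d₁, √d₂, √d₃) be a totally real field with Gal(K/ℚ) ≅ C₂×C₂×C₂. Let β_i be a fundamental unit of ℚ(√d_i) with |β_i| > 1, and choose positive integers n₁, n₂, n₃ such that the product of any two of |β₁^{n₁}|, |β₂^{n₂}|, |β₃^{n₃}| exceeds the remaining one. Then α = β₁^{n₁}β₂^{n₂}β₃^{n₃} is a Perron number satisfying M(α) = α², and hence α is a wandering unit under iteration of M. -/
open Polynomial

noncomputable def intMinpoly (α : ℂ) : Polynomial ℤ :=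
  (IsLocalization.integerNormalization (nonZeroDivisors ℤ) (minpoly ℚ α)).primPart

noncomputable def mahlerM (α : ℂ) : ℝ :=
  ((intMinpoly α).leadingCoeff.natAbs : ℝ) *
    (((intMinpoly α).map (Int.castRingHom ℂ)).roots.map (fun z => max 1 ‖z‖)).prod

noncomputable def mahlerC (α : ℂ) : ℂ := (mahlerM α : ℝ)

def TorsionFree (α : ℂ) : Prop :=
  ∀ σ : ℂ ≃ₐ[ℚ] ℂ, σ α ≠ α → ∀ n : ℕ, 0 < n → (α / σ α) ^ n ≠ 1

lemma aux_mem (d : ℕ) (x : ℝ)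
    (hx : x ∈ (IntermediateField.adjoin ℚ {Real.sqrt d} : IntermediateField ℚ ℝ)) :
    ∃ p q : ℚ, x = p + q * Real.sqrt d := by
  have hs : Real.sqrt d * Real.sqrt d = d := Real.mul_self_sqrt (Nat.cast_nonneg d)
  induction hx using IntermediateField.adjoin_induction with
  | mem x hx =>
    rw [Set.mem_singleton_iff] at hx
    exact ⟨0, 1, by rw [hx]; push_cast; ring⟩
  | algebraMap x => exact ⟨x, 0, by simp⟩
  | add x y hx hy ihx ihy =>
    obtain ⟨p, q, rfl⟩ := ihx
    obtain ⟨p', q', rfl⟩ := ihy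
    exact ⟨p + p', q + q', by push_cast; ring⟩
  | mul x y hx hy ihx ihy =>
    obtain ⟨p, q, rfl⟩ := ihx
    obtain ⟨p', q', rfl⟩ := ihy
    refine ⟨p * p' + q * q' * d, p * q' + q * p', ?_⟩
    push_cast
    linear_combination (q * q' : ℝ) * hs
  | inv x hx ihx =>
    obtain ⟨p, q, rfl⟩ := ihx
    by_cases h1 : (p + q * Real.sqrt d : ℝ) = 0
    · exact ⟨0, 0, by rw [h1]; simp⟩
    by_cases h2 : (p - q * Real.sqrt d : ℝ) = 0
    · refine ⟨(2 * p)⁻¹, 0, ?_⟩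
      have : (p + q * Real.sqrt d : ℝ) = 2 * p := by linarith
      rw [this]
      push_cast
      ring
    · have h3 : (p ^ 2 - q ^ 2 * d : ℝ) = (p + q * Real.sqrt d) * (p - q * Real.sqrt d) := by
        linear_combination (q ^ 2 : ℝ) * hs
      have h4 : (p ^ 2 - q ^ 2 * d : ℝ) ≠ 0 := by rw [h3]; exact mul_ne_zero h1 h2
      refine ⟨p / (p ^ 2 - q ^ 2 * d), - q / (p ^ 2 - q ^ 2 * d), ?_⟩
      push_cast
      apply inv_eq_of_mul_eq_one_right
      rw [div_mul_eq_mul_div, ← add_div, ← mul_div_assoc, div_eq_one_iff_eq h4, h3]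
      ring

noncomputable def inclC (K : IntermediateField ℚ ℝ) : K →ₐ[ℚ] ℂ :=
  (Complex.ofRealAm.restrictScalars ℚ).comp K.val

lemma inclC_apply (K : IntermediateField ℚ ℝ) (x : K) : inclC K x = ((x : ℝ) : ℂ) := rfl

lemma aux_int_rat (N : ℚ) (h : IsIntegral ℤ ((N : ℚ) : ℂ)) : ∃ y : ℤ, (y : ℚ) = N := by
  have h2 : IsIntegral ℤ (algebraMap ℚ ℂ N) := by simpa using h
  rw [isIntegral_algebraMap_iff (algebraMap ℚ ℂ).injective] at h2
  obtain ⟨y, hy⟩ := IsIntegrallyClosed.isIntegral_iff.mp h2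
  exact ⟨y, by simpa using hy⟩

lemma aux_conj (K : IntermediateField ℚ ℝ) (ψ : K →ₐ[ℚ] ℂ) (b r : K) (p q : ℚ) (d : ℕ)
    (hr : (r : ℝ) ^ 2 = d) (hb : b = algebraMap ℚ K p + algebraMap ℚ K q * r)
    (h1 : 1 < (b : ℝ)) (hi : IsIntegral ℤ b) (hi' : IsIntegral ℤ b⁻¹)
    (hψ : ψ r = -((r : ℝ) : ℂ)) : ‖ψ b‖ = (b : ℝ)⁻¹ := by
  have hbC : ((b : ℝ) : ℂ) = p + q * ((r : ℝ) : ℂ) := by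
    rw [← inclC_apply, ← inclC_apply, hb]; simp
  have hψb : ψ b = p - q * ((r : ℝ) : ℂ) := by
    rw [hb, map_add, map_mul, hψ]; simp; ring
  have hrC : ((r : ℝ) : ℂ) ^ 2 = d := by exact_mod_cast hr
  set N : ℚ := p ^ 2 - q ^ 2 * d with hN
  have hmul : ((b : ℝ) : ℂ) * ψ b = (N : ℂ) := by
    rw [hψb, hbC, hN]; push_cast; linear_combination (-q ^ 2 : ℂ) * hrC
  have hb0 : b ≠ 0 := by
    rintro rfl
    simp at h1
    linarith
  have hint : IsIntegral ℤ (N : ℂ) := by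
    rw [← hmul, ← inclC_apply]
    exact (hi.map (inclC K)).mul (hi.map ψ)
  have hint' : IsIntegral ℤ ((N⁻¹ : ℚ) : ℂ) := by
    have : ((N⁻¹ : ℚ) : ℂ) = inclC K b⁻¹ * ψ b⁻¹ := by
      rw [map_inv₀, map_inv₀, inclC_apply, ← mul_inv, hmul]; push_cast; rfl
    rw [this]
    exact (hi'.map (inclC K)).mul (hi'.map ψ)
  obtain ⟨y, hy⟩ := aux_int_rat _ hint
  obtain ⟨y', hy'⟩ := aux_int_rat _ hint'
  have hN0 : N ≠ 0 := by
    intro h0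
    rw [h0] at hmul
    have h2 : ((b : ℝ) : ℂ) ≠ 0 := by
      exact_mod_cast (by linarith : (b : ℝ) ≠ 0)
    have h3 : ψ b ≠ 0 := (map_ne_zero ψ).mpr hb0
    exact mul_ne_zero h2 h3 (by simpa using hmul)
  have hyy : y * y' = 1 := by
    have : (y : ℚ) * y' = 1 := by rw [hy, hy', mul_inv_cancel₀ hN0]
    exact_mod_cast this
  have hnorm : ‖(N : ℂ)‖ = 1 := by
    rw [← hy]
    rcases Int.eq_one_or_neg_one_of_mul_eq_one hyy with h | h <;> simp [h]
  have := congrArg norm hmul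
  rw [norm_mul, hnorm, Complex.norm_real, Real.norm_of_nonneg (by linarith)] at this
  exact eq_inv_of_mul_eq_one_right this

lemma intMinpoly_spec (α : ℂ) (h : IsIntegral ℤ α) :
    mahlerM α = (((minpoly ℚ α).map (algebraMap ℚ ℂ)).roots.map (fun z => max 1 ‖z‖)).prod := by
  have hQ := minpoly.isIntegrallyClosed_eq_field_fractions' ℚ h
  have hmon := minpoly.monic h
  obtain ⟨b, hb, hbe⟩ := IsLocalization.integerNormalization_spec (nonZeroDivisors ℤ) (minpoly ℚ α)
  have hb0 : b ≠ 0 := nonZeroDivisors.ne_zero hb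
  have heq : IsLocalization.integerNormalization (nonZeroDivisors ℤ) (minpoly ℚ α)
      = C b * minpoly ℤ α := by
    apply Polynomial.map_injective (algebraMap ℤ ℚ) (algebraMap ℤ ℚ).injective_int
    rw [hbe, Polynomial.map_mul, ← hQ, Polynomial.map_C, ← Polynomial.smul_eq_C_mul]
    exact (algebraMap_smul ℚ b (minpoly ℚ α)).symm
  have hne : C b * minpoly ℤ α ≠ 0 := mul_ne_zero (by simpa using hb0) hmon.ne_zero
  have h2 : intMinpoly α = (C b).primPart * minpoly ℤ α := by
    unfold intMinpoly
    rw [heq, Polynomial.primPart_mul hne, hmon.isPrimitive.primPart_eq]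
  obtain ⟨u, hu, hu2⟩ := Polynomial.isUnit_iff.mp (Polynomial.isUnit_primPart_C b)
  have h3 : ((intMinpoly α).leadingCoeff.natAbs : ℝ) = 1 := by
    rw [h2, ← hu2, Polynomial.leadingCoeff_mul, hmon.leadingCoeff,
      Polynomial.leadingCoeff_C, mul_one, Int.isUnit_iff_natAbs_eq.mp hu, Nat.cast_one]
  have h4 : ((intMinpoly α).map (Int.castRingHom ℂ)).roots
      = ((minpoly ℚ α).map (algebraMap ℚ ℂ)).roots := by
    rw [h2, ← hu2, hQ, Polynomial.map_map, Polynomial.map_mul, Polynomial.map_C,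
      Polynomial.roots_C_mul]
    · rfl
    · simpa using hu.ne_zero
  unfold mahlerM
  rw [h3, h4, one_mul]

lemma core (K : IntermediateField ℚ ℝ) [FiniteDimensional ℚ K] (x : K) (a b c : ℝ)
    (ha : 1 < a) (hb : 1 < b) (hc : 1 < c)
    (h1 : c < a * b) (h2 : b < a * c) (h3 : a < b * c)
    (hx : (x : ℝ) = a * b * c) (e : (K →ₐ[ℚ] ℂ) ≃ Bool × Bool × Bool)
    (hn : ∀ ψ : K →ₐ[ℚ] ℂ, ‖ψ x‖ = (if (e ψ).1 then a else a⁻¹) *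
      (if (e ψ).2.1 then b else b⁻¹) * (if (e ψ).2.2 then c else c⁻¹))
    (hint : IsIntegral ℤ x) :
    (∀ z ∈ ((minpoly ℚ ((x : ℝ) : ℂ)).map (algebraMap ℚ ℂ)).roots,
          z ≠ ((x : ℝ) : ℂ) → ‖z‖ < (x : ℝ)) ∧ mahlerM ((x : ℝ) : ℂ) = (x : ℝ) ^ 2 := by
  classical
  have hmp : minpoly ℚ ((x : ℝ) : ℂ) = minpoly ℚ x := by
    rw [← inclC_apply]
    exact minpoly.algHom_eq (inclC K) (inclC K).injective x
  have ha' : a⁻¹ < 1 := inv_lt_one_of_one_lt₀ ha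
  have hb' : b⁻¹ < 1 := inv_lt_one_of_one_lt₀ hb
  have hc' : c⁻¹ < 1 := inv_lt_one_of_one_lt₀ hc
  have ha0 : 0 < a⁻¹ := by positivity
  have hb0 : 0 < b⁻¹ := by positivity
  have hc0 : 0 < c⁻¹ := by positivity
  have hsmall : ∀ ψ : K →ₐ[ℚ] ℂ, e ψ ≠ (true, true, true) → ‖ψ x‖ < (x : ℝ) := by
    intro ψ hψ
    rw [hn, hx]
    have A : (if (e ψ).1 then a else a⁻¹) ≤ a := by split_ifs <;> linarith
    have B : (if (e ψ).2.1 then b else b⁻¹) ≤ b := by split_ifs <;> linarith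
    have C : (if (e ψ).2.2 then c else c⁻¹) ≤ c := by split_ifs <;> linarith
    have A0 : 0 < (if (e ψ).1 then a else a⁻¹) := by split_ifs <;> linarith
    have B0 : 0 < (if (e ψ).2.1 then b else b⁻¹) := by split_ifs <;> linarith
    have C0 : 0 < (if (e ψ).2.2 then c else c⁻¹) := by split_ifs <;> linarith
    rcases hE : e ψ with ⟨s, t, u⟩
    rw [hE] at hψ A B C A0 B0 C0
    by_cases hu : u = true
    · by_cases ht : t = true
      · have hs : ¬ s = true := fun hs => hψ (by simp [hs, ht, hu])
        have A' : (if s = true then a else a⁻¹) < a := by rw [if_neg hs]; linarith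
        exact mul_lt_mul (mul_lt_mul A' B B0 (by linarith)) C C0 (by positivity)
      · have B' : (if t = true then b else b⁻¹) < b := by rw [if_neg ht]; linarith
        exact mul_lt_mul (mul_lt_mul' A B' B0.le (by linarith)) C C0 (by positivity)
    · have C' : (if u = true then c else c⁻¹) < c := by rw [if_neg hu]; linarith
      exact mul_lt_mul' (mul_le_mul A B B0.le (by linarith)) C' C0.le (by positivity)
  have hself : ‖inclC K x‖ = (x : ℝ) := by
    rw [inclC_apply, Complex.norm_real, Real.norm_of_nonneg]
    rw [hx]; positivity
  have heI : e (inclC K) = (true, true, true) := by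
    by_contra hne
    exact absurd (hsmall _ hne) (by rw [hself]; exact lt_irrefl _)
  have hinj : Function.Injective fun ψ : K →ₐ[ℚ] ℂ => ψ x := by
    rw [← Field.primitive_element_iff_algHom_eq_of_eval' ℚ ℂ (fun y => IsAlgClosed.splits _),
      Field.primitive_element_iff_algHom_eq_of_eval ℚ ℂ (fun y => IsAlgClosed.splits _) x (inclC K)]
    intro ψ hψ
    by_contra hne
    have : e ψ ≠ (true, true, true) := by
      rw [← heI]; exact fun h => hne (e.injective h).symm
    have := hsmall ψ this
    rw [← hψ, hself] at this
    exact lt_irrefl _ this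
  have hmem : ∀ z, z ∈ ((minpoly ℚ x).map (algebraMap ℚ ℂ)).roots ↔ ∃ ψ : K →ₐ[ℚ] ℂ, ψ x = z := by
    intro z
    have := Set.ext_iff.mp (Algebra.IsAlgebraic.range_eval_eq_rootSet_minpoly (F := ℚ) ℂ x) z
    rw [Polynomial.rootSet, Finset.mem_coe, Multiset.mem_toFinset] at this
    exact this.symm
  have hroots : ((minpoly ℚ x).map (algebraMap ℚ ℂ)).roots
      = (Finset.univ : Finset (K →ₐ[ℚ] ℂ)).val.map (fun ψ => ψ x) := by
    rw [Multiset.Nodup.ext]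
    · intro z
      rw [hmem]; simp
    · apply Polynomial.nodup_roots
      apply Polynomial.Separable.map
      exact Algebra.IsSeparable.isSeparable ℚ x
    · exact Multiset.Nodup.map hinj Finset.univ.nodup
  have hintC : IsIntegral ℤ ((x : ℝ) : ℂ) := by
    rw [← inclC_apply]; exact hint.map (inclC K)
  refine ⟨?_, ?_⟩
  · intro z hz hzx
    rw [hmp, hmem] at hz
    obtain ⟨ψ, rfl⟩ := hz
    apply hsmall
    intro h
    rw [← heI] at h
    apply hzx
    rw [e.injective h, inclC_apply]
  · rw [intMinpoly_spec _ hintC, hmp, hroots, Multiset.map_map]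
    change ∏ ψ : K →ₐ[ℚ] ℂ, max 1 ‖ψ x‖ = _
    have : ∀ ψ : K →ₐ[ℚ] ℂ, max 1 ‖ψ x‖ = (fun s : Bool × Bool × Bool => max 1 ((if s.1 then a else a⁻¹) *
      (if s.2.1 then b else b⁻¹) * (if s.2.2 then c else c⁻¹))) (e ψ) := fun ψ => by rw [hn]
    rw [Finset.prod_congr rfl (fun ψ _ => this ψ)]
    refine (Equiv.prod_comp e (fun s : Bool × Bool × Bool => max (1 : ℝ)
      ((if s.1 then a else a⁻¹) * (if s.2.1 then b else b⁻¹) *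
        (if s.2.2 then c else c⁻¹)))).trans ?_
    rw [Fintype.prod_prod_type]
    simp only [Fintype.prod_prod_type, Fintype.prod_bool, if_true, Bool.false_eq_true, if_false]
    have e1 : max 1 (a * b * c) = a * b * c := max_eq_right (by
      nlinarith [mul_pos (sub_pos.mpr ha) (sub_pos.mpr hb)])
    have e2 : max 1 (a * b * c⁻¹) = a * b * c⁻¹ := max_eq_right (by
      rw [← div_eq_mul_inv, le_div_iff₀ (by linarith)]; linarith)
    have e3 : max 1 (a * b⁻¹ * c) = a * b⁻¹ * c := max_eq_right (by
      rw [mul_right_comm, ← div_eq_mul_inv, le_div_iff₀ (by linarith)]; linarith)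
    have e4 : max 1 (a⁻¹ * b * c) = a⁻¹ * b * c := max_eq_right (by
      rw [mul_assoc, mul_comm, ← div_eq_mul_inv, le_div_iff₀ (by linarith)]; linarith)
    have e5 : max 1 (a * b⁻¹ * c⁻¹) = 1 := max_eq_left (by
      rw [mul_assoc, ← mul_inv, ← div_eq_mul_inv, div_le_one (by positivity)]; linarith)
    have e6 : max 1 (a⁻¹ * b * c⁻¹) = 1 := max_eq_left (by
      rw [mul_comm a⁻¹, mul_assoc, ← mul_inv, ← div_eq_mul_inv, div_le_one (by positivity)]; linarith)
    have e7 : max 1 (a⁻¹ * b⁻¹ * c) = 1 := max_eq_left (by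
      rw [mul_comm _ c, ← mul_inv, ← div_eq_mul_inv, div_le_one (by positivity)]; linarith)
    have e8 : max 1 (a⁻¹ * b⁻¹ * c⁻¹) = 1 := max_eq_left (by
      have := mul_le_one₀ ha'.le hb0.le hb'.le
      exact mul_le_one₀ this hc0.le hc'.le)
    rw [e1, e2, e3, e4, e5, e6, e7, e8, hx]
    field_simp

theorem triquadratic_totally_real_wandering (d₁ d₂ d₃ : ℕ)
    (hd₁ : 2 ≤ d₁) (hd₂ : 2 ≤ d₂) (hd₃ : 2 ≤ d₃)
    (hsf₁ : Squarefree d₁) (hsf₂ : Squarefree d₂) (hsf₃ : Squarefree d₃)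
    (K : IntermediateField ℚ ℝ)
    (hKdef : K = IntermediateField.adjoin ℚ
      {Real.sqrt d₁, Real.sqrt d₂, Real.sqrt d₃})
    (hK8 : Module.finrank ℚ K = 8)
    (hGalois : IsGalois ℚ K) (hC2 : ∀ g : K ≃ₐ[ℚ] K, g * g = 1)
    (β₁ : (IntermediateField.adjoin ℚ {Real.sqrt d₁} : IntermediateField ℚ ℝ))
    (β₂ : (IntermediateField.adjoin ℚ {Real.sqrt d₂} : IntermediateField ℚ ℝ))
    (β₃ : (IntermediateField.adjoin ℚ {Real.sqrt d₃} : IntermediateField ℚ ℝ))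
    (hβ₁ : 1 < (β₁ : ℝ) ∧ IsIntegral ℤ β₁ ∧ IsIntegral ℤ β₁⁻¹ ∧
      ∀ γ, γ ≠ 0 → IsIntegral ℤ γ → IsIntegral ℤ γ⁻¹ →
        ∃ k : ℤ, γ = β₁ ^ k ∨ γ = -β₁ ^ k)
    (hβ₂ : 1 < (β₂ : ℝ) ∧ IsIntegral ℤ β₂ ∧ IsIntegral ℤ β₂⁻¹ ∧
      ∀ γ, γ ≠ 0 → IsIntegral ℤ γ → IsIntegral ℤ γ⁻¹ →
        ∃ k : ℤ, γ = β₂ ^ k ∨ γ = -β₂ ^ k)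
    (hβ₃ : 1 < (β₃ : ℝ) ∧ IsIntegral ℤ β₃ ∧ IsIntegral ℤ β₃⁻¹ ∧
      ∀ γ, γ ≠ 0 → IsIntegral ℤ γ → IsIntegral ℤ γ⁻¹ →
        ∃ k : ℤ, γ = β₃ ^ k ∨ γ = -β₃ ^ k)
    (n₁ n₂ n₃ : ℕ) (hn₁ : 0 < n₁) (hn₂ : 0 < n₂) (hn₃ : 0 < n₃)
    (hbal₁ : (β₁ : ℝ) ^ n₁ * (β₂ : ℝ) ^ n₂ > (β₃ : ℝ) ^ n₃)
    (hbal₂ : (β₁ : ℝ) ^ n₁ * (β₃ : ℝ) ^ n₃ > (β₂ : ℝ) ^ n₂)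
    (hbal₃ : (β₂ : ℝ) ^ n₂ * (β₃ : ℝ) ^ n₃ > (β₁ : ℝ) ^ n₁) :
    ∀ α : ℝ, α = (β₁ : ℝ) ^ n₁ * (β₂ : ℝ) ^ n₂ * (β₃ : ℝ) ^ n₃ →
      (1 < α ∧ IsIntegral ℤ α ∧ IsIntegral ℤ α⁻¹ ∧
        ∀ z ∈ ((minpoly ℚ (α : ℂ)).map (algebraMap ℚ ℂ)).roots,
          z ≠ (α : ℂ) → ‖z‖ < α) ∧
      mahlerM (α : ℂ) = α ^ 2 ∧
      (Set.range fun m : ℕ => mahlerC^[m] (α : ℂ)).Infinite := by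
  intro α hα
  classical
  have hfd : FiniteDimensional ℚ K := Module.finite_of_finrank_pos (by omega)
  have hle : ∀ d : ℕ, Real.sqrt d ∈ ({Real.sqrt d₁, Real.sqrt d₂, Real.sqrt d₃} : Set ℝ) →
      (IntermediateField.adjoin ℚ {Real.sqrt d} : IntermediateField ℚ ℝ) ≤ K := by
    intro d hd
    rw [hKdef]
    exact IntermediateField.adjoin.mono _ _ _ (Set.singleton_subset_iff.mpr hd)
  have hle₁ := hle d₁ (by simp)
  have hle₂ := hle d₂ (by simp)
  have hle₃ := hle d₃ (by simp)
  have hr : ∀ d : ℕ, (IntermediateField.adjoin ℚ {Real.sqrt d} : IntermediateField ℚ ℝ) ≤ K →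
      Real.sqrt d ∈ K := fun d h => h (IntermediateField.mem_adjoin_simple_self ℚ _)
  let r₁ : K := ⟨Real.sqrt d₁, hr d₁ hle₁⟩
  let r₂ : K := ⟨Real.sqrt d₂, hr d₂ hle₂⟩
  let r₃ : K := ⟨Real.sqrt d₃, hr d₃ hle₃⟩
  have hsg : ∀ (d : ℕ) (h : Real.sqrt d ∈ K) (ψ : K →ₐ[ℚ] ℂ),
      ψ ⟨Real.sqrt d, h⟩ ≠ ((Real.sqrt d : ℝ) : ℂ) →
        ψ ⟨Real.sqrt d, h⟩ = -((Real.sqrt d : ℝ) : ℂ) := by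
    intro d h ψ hne
    have e1 : (⟨Real.sqrt d, h⟩ : K) ^ 2 = (d : K) := by
      apply Subtype.ext
      simp
    have e2 : (ψ ⟨Real.sqrt d, h⟩) ^ 2 = ((Real.sqrt d : ℝ) : ℂ) ^ 2 := by
      rw [← map_pow, e1, map_natCast, ← Complex.ofReal_pow, Real.sq_sqrt (Nat.cast_nonneg d)]
      simp
    exact (sq_eq_sq_iff_eq_or_eq_neg.mp e2).resolve_left hne
  let f : (K →ₐ[ℚ] ℂ) → Bool × Bool × Bool := fun ψ =>
    (decide (ψ r₁ = ((Real.sqrt d₁ : ℝ) : ℂ)), decide (ψ r₂ = ((Real.sqrt d₂ : ℝ) : ℂ)),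
      decide (ψ r₃ = ((Real.sqrt d₃ : ℝ) : ℂ)))
  have hdec : ∀ (d : ℕ) (h : Real.sqrt d ∈ K) (ψ φ : K →ₐ[ℚ] ℂ),
      decide (ψ ⟨Real.sqrt d, h⟩ = ((Real.sqrt d : ℝ) : ℂ))
        = decide (φ ⟨Real.sqrt d, h⟩ = ((Real.sqrt d : ℝ) : ℂ)) →
      ψ ⟨Real.sqrt d, h⟩ = φ ⟨Real.sqrt d, h⟩ := by
    intro d h ψ φ hd
    rw [decide_eq_decide] at hd
    by_cases h1 : ψ ⟨Real.sqrt d, h⟩ = ((Real.sqrt d : ℝ) : ℂ)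
    · rw [h1, hd.mp h1]
    · rw [hsg d h ψ h1, hsg d h φ (fun h2 => h1 (hd.mpr h2))]
  have hfinj : Function.Injective f := by
    intro ψ φ h
    simp only [f, Prod.mk.injEq] at h
    obtain ⟨g1, g2, g3⟩ := h
    apply IntermediateField.algHom_ext_of_eq_adjoin ℚ hKdef
    intro x hx
    rcases hx with rfl | rfl | rfl
    · exact hdec _ _ _ _ g1
    · exact hdec _ _ _ _ g2
    · exact hdec _ _ _ _ g3
  have hfbij : Function.Bijective f := by
    rw [Fintype.bijective_iff_injective_and_card]
    refine ⟨hfinj, ?_⟩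
    rw [AlgHom.card ℚ K ℂ, hK8]
    rfl
  let e := Equiv.ofBijective f hfbij
  have hkey : ∀ (d : ℕ) (h : (IntermediateField.adjoin ℚ {Real.sqrt d} : IntermediateField ℚ ℝ) ≤ K)
      (β : (IntermediateField.adjoin ℚ {Real.sqrt d} : IntermediateField ℚ ℝ))
      (h1 : 1 < (β : ℝ)) (hi : IsIntegral ℤ β) (hi' : IsIntegral ℤ β⁻¹) (n : ℕ),
      IsIntegral ℤ (⟨β, h β.2⟩ : K) ∧ IsIntegral ℤ (⟨β, h β.2⟩ : K)⁻¹ ∧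
      ∀ ψ : K →ₐ[ℚ] ℂ, ‖ψ ((⟨β, h β.2⟩ : K) ^ n)‖ =
        if decide (ψ ⟨Real.sqrt d, hr d h⟩ = ((Real.sqrt d : ℝ) : ℂ)) = true
          then (β : ℝ) ^ n else ((β : ℝ) ^ n)⁻¹ := by
    intro d h β h1 hi hi' n
    have I1 : IsIntegral ℤ (⟨β, h β.2⟩ : K) := hi.map (IntermediateField.inclusion h)
    have I2 : IsIntegral ℤ (⟨β, h β.2⟩ : K)⁻¹ := by
      have := hi'.map (IntermediateField.inclusion h)
      rwa [map_inv₀] at this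
    refine ⟨I1, I2, ?_⟩
    intro ψ
    obtain ⟨p, q, hpq⟩ := aux_mem d β β.2
    have hb : (⟨β, h β.2⟩ : K) = algebraMap ℚ K p + algebraMap ℚ K q * ⟨Real.sqrt d, hr d h⟩ := by
      apply Subtype.ext
      simpa using hpq
    rw [map_pow, norm_pow]
    by_cases hc : ψ ⟨Real.sqrt d, hr d h⟩ = ((Real.sqrt d : ℝ) : ℂ)
    · rw [if_pos (by simpa using hc)]
      congr 1
      have : ψ ⟨β, h β.2⟩ = ((β : ℝ) : ℂ) := by
        rw [hb, map_add, map_mul, hc, hpq]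
        simp
      rw [this, Complex.norm_real, Real.norm_of_nonneg (by linarith)]
    · rw [if_neg (by simpa using hc), ← inv_pow]
      congr 1
      exact aux_conj K ψ _ _ p q d (Real.sq_sqrt (Nat.cast_nonneg d)) hb h1 I1 I2 (hsg d _ ψ hc)
  have hmain : ∀ k : ℕ, 0 < k →
      (1 < α ^ k ∧ IsIntegral ℤ (α ^ k) ∧ IsIntegral ℤ (α ^ k)⁻¹ ∧
        ∀ z ∈ ((minpoly ℚ ((α ^ k : ℝ) : ℂ)).map (algebraMap ℚ ℂ)).roots,
          z ≠ ((α ^ k : ℝ) : ℂ) → ‖z‖ < α ^ k) ∧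
      mahlerM ((α ^ k : ℝ) : ℂ) = (α ^ k) ^ 2 := by
    intro k hk
    obtain ⟨I1, J1, N1⟩ := hkey d₁ hle₁ β₁ hβ₁.1 hβ₁.2.1 hβ₁.2.2.1 (n₁ * k)
    obtain ⟨I2, J2, N2⟩ := hkey d₂ hle₂ β₂ hβ₂.1 hβ₂.2.1 hβ₂.2.2.1 (n₂ * k)
    obtain ⟨I3, J3, N3⟩ := hkey d₃ hle₃ β₃ hβ₃.1 hβ₃.2.1 hβ₃.2.2.1 (n₃ * k)
    set b₁ : K := ⟨β₁, hle₁ β₁.2⟩ with hb₁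
    set b₂ : K := ⟨β₂, hle₂ β₂.2⟩ with hb₂
    set b₃ : K := ⟨β₃, hle₃ β₃.2⟩ with hb₃
    set x : K := b₁ ^ (n₁ * k) * b₂ ^ (n₂ * k) * b₃ ^ (n₃ * k) with hxdef
    have hx : (x : ℝ) = (β₁ : ℝ) ^ (n₁ * k) * (β₂ : ℝ) ^ (n₂ * k) * (β₃ : ℝ) ^ (n₃ * k) := by
      simp [hxdef, hb₁, hb₂, hb₃]
    have hxα : (x : ℝ) = α ^ k := by
      rw [hx, hα, mul_pow, mul_pow, pow_mul, pow_mul, pow_mul]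
    have hxint : IsIntegral ℤ x := ((I1.pow _).mul (I2.pow _)).mul (I3.pow _)
    have hxint' : IsIntegral ℤ x⁻¹ := by
      rw [hxdef, mul_inv, mul_inv, ← inv_pow, ← inv_pow, ← inv_pow]
      exact ((J1.pow _).mul (J2.pow _)).mul (J3.pow _)
    have p1 : 0 < (β₁ : ℝ) := by linarith [hβ₁.1]
    have p2 : 0 < (β₂ : ℝ) := by linarith [hβ₂.1]
    have p3 : 0 < (β₃ : ℝ) := by linarith [hβ₃.1]
    have g1 : 1 < (β₁ : ℝ) ^ (n₁ * k) := one_lt_pow₀ hβ₁.1 (by positivity)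
    have g2 : 1 < (β₂ : ℝ) ^ (n₂ * k) := one_lt_pow₀ hβ₂.1 (by positivity)
    have g3 : 1 < (β₃ : ℝ) ^ (n₃ * k) := one_lt_pow₀ hβ₃.1 (by positivity)
    have l1 : (β₃ : ℝ) ^ (n₃ * k) < (β₁ : ℝ) ^ (n₁ * k) * (β₂ : ℝ) ^ (n₂ * k) := by
      rw [pow_mul, pow_mul, pow_mul, ← mul_pow]
      exact pow_lt_pow_left₀ hbal₁ (by positivity) hk.ne'
    have l2 : (β₂ : ℝ) ^ (n₂ * k) < (β₁ : ℝ) ^ (n₁ * k) * (β₃ : ℝ) ^ (n₃ * k) := by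
      rw [pow_mul, pow_mul, pow_mul, ← mul_pow]
      exact pow_lt_pow_left₀ hbal₂ (by positivity) hk.ne'
    have l3 : (β₁ : ℝ) ^ (n₁ * k) < (β₂ : ℝ) ^ (n₂ * k) * (β₃ : ℝ) ^ (n₃ * k) := by
      rw [pow_mul, pow_mul, pow_mul, ← mul_pow]
      exact pow_lt_pow_left₀ hbal₃ (by positivity) hk.ne'
    have hcore := core K x _ _ _ g1 g2 g3 l1 l2 l3 hx e (by
      intro ψ
      rw [hxdef, map_mul, map_mul, norm_mul, norm_mul, N1, N2, N3]
      rfl) hxint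
    rw [hxα] at hcore
    refine ⟨⟨?_, ?_, ?_, hcore.1⟩, hcore.2⟩
    · rw [← hxα, hx]
      exact one_lt_mul_of_lt_of_le (one_lt_mul_of_lt_of_le g1 g2.le) g3.le
    · rw [← hxα]
      exact hxint.map K.val
    · rw [← hxα]
      have := hxint'.map K.val
      rwa [map_inv₀] at this
  have h1 := hmain 1 one_pos
  rw [pow_one] at h1
  refine ⟨h1.1, h1.2, ?_⟩
  have hiter : ∀ m : ℕ, mahlerC^[m] (α : ℂ) = ((α ^ (2 ^ m) : ℝ) : ℂ) := by
    intro m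
    induction m with
    | zero => simp
    | succ m ih =>
      rw [Function.iterate_succ_apply', ih, mahlerC, (hmain (2 ^ m) (by positivity)).2,
        ← pow_mul, ← pow_succ]
  apply Set.infinite_range_of_injective
  intro m m' h
  simp only [hiter] at h
  have h' : α ^ (2 ^ m) = α ^ (2 ^ m') := by exact_mod_cast h
  have h'' := (pow_right_injective₀ (by linarith [h1.1.1]) (ne_of_gt h1.1.1)) h'
  exact Nat.pow_right_injective le_rfl h''
end

section
/- Let K/ℚ be an abelian number field. Then every element of K is preperiodic under iteration of the Mahler measure M if and only if the maximal totally real subfield K⁺ of K has Galois group over ℚ isomorphic to C₁, C₂, C₃, or C₂×C₂. In all other cases K contains an algebraic unit that wanders under iteration of M. -/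
open Polynomial

lemma intMinpoly_map (α : ℂ) (h : IsIntegral ℚ α) :
    ∃ c : ℚ, c ≠ 0 ∧ (intMinpoly α).map (Int.castRingHom ℚ) = C c * minpoly ℚ α := by
  obtain ⟨b, hb, hb2⟩ := IsLocalization.integerNormalization_spec (nonZeroDivisors ℤ) (minpoly ℚ α)
  set P := IsLocalization.integerNormalization (nonZeroDivisors ℤ) (minpoly ℚ α) with hP
  have hP0 : P ≠ 0 := by
    intro h0
    rw [hP, IsFractionRing.integerNormalization_eq_zero_iff] at h0
    exact minpoly.ne_zero h h0
  have hc : P.content ≠ 0 := by rwa [Ne, content_eq_zero_iff]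
  have hb0 : b ≠ 0 := nonZeroDivisors.ne_zero hb
  have hc' : (P.content : ℚ) ≠ 0 := by exact_mod_cast hc
  have hb' : (b : ℚ) ≠ 0 := by exact_mod_cast hb0
  refine ⟨(b : ℚ) / P.content, div_ne_zero hb' hc', ?_⟩
  have e : P.map (Int.castRingHom ℚ) = C (P.content : ℚ) * (intMinpoly α).map (Int.castRingHom ℚ) := by
    conv_lhs => rw [P.eq_C_content_mul_primPart]
    rw [Polynomial.map_mul, Polynomial.map_C]
    rfl
  have e2 : P.map (Int.castRingHom ℚ) = C (b : ℚ) * minpoly ℚ α := by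
    rw [← smul_eq_C_mul]
    have : ((b:ℚ) • minpoly ℚ α) = b • minpoly ℚ α := by
      rw [Int.cast_smul_eq_zsmul]
    rw [this]
    exact hb2
  have hC : (C (P.content : ℚ)) ≠ 0 := by simpa using hc
  apply mul_left_cancel₀ hC
  rw [← e, e2, ← mul_assoc, ← C_mul, mul_div_cancel₀ _ hc']

lemma intMinpoly_primitive (α : ℂ) : (intMinpoly α).IsPrimitive := isPrimitive_primPart _

lemma intMinpoly_roots (α : ℂ) (h : IsIntegral ℚ α) :
    ((intMinpoly α).map (Int.castRingHom ℂ)).roots = (minpoly ℚ α).aroots ℂ := by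
  obtain ⟨c, hc, e⟩ := intMinpoly_map α h
  have : (Int.castRingHom ℂ) = (algebraMap ℚ ℂ).comp (Int.castRingHom ℚ) := RingHom.ext_int _ _
  rw [this, ← Polynomial.map_map, e, Polynomial.map_mul, Polynomial.map_C, aroots_def,
    Polynomial.roots_C_mul]
  simpa using hc

lemma intMinpoly_lc (α : ℂ) (h : IsIntegral ℤ α) : (intMinpoly α).leadingCoeff.natAbs = 1 := by
  have hQ : IsIntegral ℚ α := h.tower_top
  obtain ⟨c, hc, e⟩ := intMinpoly_map α hQ
  have e2 : minpoly ℚ α = (minpoly ℤ α).map (Int.castRingHom ℚ) :=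
    minpoly.isIntegrallyClosed_eq_field_fractions' ℚ h
  have hd : intMinpoly α ∣ minpoly ℤ α := by
    rw [IsPrimitive.Int.dvd_iff_map_cast_dvd_map_cast _ _ (intMinpoly_primitive α), e, ← e2]
    refine ⟨C c⁻¹, ?_⟩
    rw [mul_comm, ← mul_assoc, ← C_mul, inv_mul_cancel₀ hc]; simp
  obtain ⟨q, hq⟩ := hd
  have : (intMinpoly α).leadingCoeff * q.leadingCoeff = 1 := by
    rw [← leadingCoeff_mul, ← hq]; exact minpoly.monic h
  exact Int.natAbs_of_isUnit (IsUnit.of_mul_eq_one _ this)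

lemma lc_mul_root_integral (f : ℂ[X]) (hf : ∀ i, IsIntegral ℤ (f.coeff i)) (z : ℂ)
    (hz : f.eval z = 0) : IsIntegral ℤ (f.leadingCoeff * z) := by
  have : f ∈ lifts (algebraMap (integralClosure ℤ ℂ) ℂ) := by
    rw [lifts_iff_coeff_lifts]
    intro n
    exact ⟨⟨f.coeff n, hf n⟩, rfl⟩
  obtain ⟨g, hg⟩ := (mem_lifts _).1 this
  have h1 : aeval z g = 0 := by
    rw [aeval_def, ← eval_map, hg, hz]
  have h2 := isIntegral_leadingCoeff_smul g z h1
  have h3 := isIntegral_trans (R := ℤ) (A := integralClosure ℤ ℂ) _ h2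
  have h4 : f.leadingCoeff = algebraMap (integralClosure ℤ ℂ) ℂ g.leadingCoeff := by
    rw [← hg, leadingCoeff_map_of_injective Subtype.val_injective]
  rwa [h4, ← Algebra.smul_def]

lemma div_root_integral (z : ℂ) : ∀ (n : ℕ) (q : ℂ[X]), q.natDegree ≤ n →
    (∀ i, IsIntegral ℤ (((X - C z) * q).coeff i)) → ∀ i, IsIntegral ℤ (q.coeff i) := by
  intro n
  induction n with
  | zero =>
    intro q hq h i
    obtain ⟨a, rfl⟩ := natDegree_eq_zero.1 (Nat.le_zero.1 hq)
    have := h 1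
    rcases i with _ | i
    · rw [coeff_mul_C] at this
      simp only [coeff_sub, coeff_X_one, coeff_C_succ, sub_zero, one_mul] at this
      simpa using this
    · simp [isIntegral_zero]
  | succ n ih =>
    intro q hq h
    by_cases hq0 : q = 0
    · subst hq0; intro i; simp [isIntegral_zero]
    have hlc : ((X - C z) * q).leadingCoeff = q.leadingCoeff := by
      rw [leadingCoeff_mul, leadingCoeff_X_sub_C, one_mul]
    have ha : IsIntegral ℤ q.leadingCoeff := by rw [← hlc]; exact h _
    have haz : IsIntegral ℤ (q.leadingCoeff * z) := by
      have := lc_mul_root_integral _ h z (by simp)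
      rwa [hlc] at this
    have key : ∀ i, IsIntegral ℤ (((X - C z) * q.eraseLead).coeff i) := by
      intro i
      have e : q.eraseLead = q - monomial q.natDegree q.leadingCoeff := by
        rw [self_sub_monomial_natDegree_leadingCoeff]
      have e2 : (X - C z) * q.eraseLead = (X - C z) * q -
          (monomial (q.natDegree + 1) q.leadingCoeff
            - monomial q.natDegree (q.leadingCoeff * z)) := by
        rw [e, mul_sub, sub_mul X _ (monomial _ _), X_mul_monomial, C_mul_monomial, mul_comm z]
      rw [e2, coeff_sub, coeff_sub, coeff_monomial, coeff_monomial]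
      refine (h i).sub (IsIntegral.sub ?_ ?_) <;> split_ifs <;>
        first | assumption | exact isIntegral_zero
    have := ih q.eraseLead (by have := eraseLead_natDegree_le q; omega) key
    intro i
    rw [← eraseLead_add_monomial_natDegree_leadingCoeff q, coeff_add, coeff_monomial]
    refine (this i).add ?_
    split_ifs
    · exact ha
    · exact isIntegral_zero

lemma coeff_integral_of_split (T : Multiset ℂ) : ∀ (q : ℂ[X]),
    (∀ i, IsIntegral ℤ (((T.map (fun z => X - C z)).prod * q).coeff i)) →
    ∀ i, IsIntegral ℤ (q.coeff i) := by
  induction T using Multiset.induction with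
  | empty => intro q h; simpa using h
  | cons a T ih =>
    intro q h
    apply ih
    apply div_root_integral a _ _ le_rfl
    simpa [mul_assoc] using h

lemma integral_lc_prod (p : ℤ[X]) (S : Multiset ℂ)
    (hS : S ≤ (p.map (Int.castRingHom ℂ)).roots) :
    IsIntegral ℤ ((p.leadingCoeff : ℂ) * S.prod) := by
  obtain ⟨T, hT⟩ := Multiset.le_iff_exists_add.1 hS
  have e := (IsAlgClosed.splits (p.map (Int.castRingHom ℂ))).eq_prod_roots
  rw [leadingCoeff_map_of_injective (Int.cast_injective (α := ℂ))] at e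
  have h := coeff_integral_of_split T (C (p.leadingCoeff : ℂ) * (S.map (fun z => X - C z)).prod) (by
    intro i
    have : (T.map (fun z => X - C z)).prod *
      (C (p.leadingCoeff : ℂ) * (S.map (fun z => X - C z)).prod) = p.map (Int.castRingHom ℂ) := by
      conv_rhs => rw [e, hT, Multiset.map_add, Multiset.prod_add]
      simp only [eq_intCast]
      ring
    rw [this, coeff_map]
    exact isIntegral_algebraMap (R := ℤ) (A := ℂ)) 0
  rw [coeff_C_mul, coeff_zero_eq_eval_zero, eval_multiset_prod] at h
  simp only [Multiset.map_map, Function.comp_def, eval_sub, eval_X, eval_C, zero_sub] at h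
  have e3 : (S.map (fun z => -z)).prod = (-1) ^ (Multiset.card S) * S.prod := by
    simp
  rw [e3] at h
  have h5 : IsIntegral ℤ ((-1 : ℂ) ^ (Multiset.card S)) := (isIntegral_one.neg).pow _
  have := h5.mul h
  have e4 : (-1 : ℂ) ^ (Multiset.card S) * (p.leadingCoeff * ((-1) ^ (Multiset.card S) * S.prod))
      = ((-1) ^ (Multiset.card S) * (-1) ^ (Multiset.card S)) * (p.leadingCoeff * S.prod) := by ring
  rw [e4, ← mul_pow] at this
  simpa using this


lemma one_le_prod_real {ι : Type*} (s : Finset ι) (f : ι → ℝ) (h : ∀ i ∈ s, 1 ≤ f i) :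
    1 ≤ ∏ i ∈ s, f i :=
  Finset.prod_induction f (fun t => 1 ≤ t) (fun _ _ ha hb => one_le_mul_of_one_le_of_one_le ha hb)
    le_rfl h

set_option linter.unusedSectionVars false

section Lfield
variable {L : Type*} [Field L] [NumberField L] [IsGalois ℚ L]

open Classical in
lemma mahlerM_eq_prod_image (r : L →+* ℝ) (x : L) (hx : IsIntegral ℤ x) :
    mahlerM ((r x : ℝ) : ℂ) =
      ∏ z ∈ Finset.univ.image (fun g : L ≃ₐ[ℚ] L => r (g x)), max 1 |z| := by
  set ι : L →ₐ[ℚ] ℂ := (Complex.ofRealHom.comp r).toRatAlgHom with hι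
  have hιx : ∀ y : L, ι y = ((r y : ℝ) : ℂ) := fun y => rfl
  have hIsInt : IsIntegral ℤ ((r x : ℝ) : ℂ) := by
    have := hx.map (ι : L →+* ℂ).toIntAlgHom
    exact this
  have hQ : IsIntegral ℚ ((r x : ℝ) : ℂ) := hIsInt.tower_top
  have hxQ : IsIntegral ℚ x := hx.tower_top
  have hmin : minpoly ℚ ((r x : ℝ) : ℂ) = minpoly ℚ x := by
    rw [← hιx]; exact minpoly.algHom_eq ι ι.injective x
  have hroots : (minpoly ℚ ((r x : ℝ) : ℂ)).aroots ℂ =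
      ((Finset.univ.image (fun g : L ≃ₐ[ℚ] L => r (g x))).image (fun t : ℝ => (t : ℂ))).val := by
    apply (Multiset.Nodup.ext _ (Finset.nodup _)).2
    · intro z
      rw [Finset.mem_val, hmin, Polynomial.mem_aroots]
      simp only [Finset.mem_image, Finset.mem_univ, true_and, exists_exists_eq_and]
      constructor
      · rintro ⟨h0, hz⟩
        have hs : ((minpoly ℚ x).map (algebraMap ℚ L)).Splits := IsGalois.splits ℚ x
        have hr : ((minpoly ℚ x).map (algebraMap ℚ ℂ)).roots =
            (((minpoly ℚ x).map (algebraMap ℚ L)).roots).map ι := by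
          have := hs.roots_map_of_injective (i := (ι : L →+* ℂ)) ι.injective
          rw [Polynomial.map_map] at this
          have e1 : (ι : L →+* ℂ).comp (algebraMap ℚ L) = algebraMap ℚ ℂ := by
            ext
            simp
          rw [e1] at this
          exact this
        have hz2 : z ∈ ((minpoly ℚ x).map (algebraMap ℚ ℂ)).roots := by
          rw [← aroots_def, mem_aroots]; exact ⟨h0, hz⟩
        rw [hr, Multiset.mem_map] at hz2
        obtain ⟨y, hy, rfl⟩ := hz2
        have hc : IsConjRoot ℚ x y := (isConjRoot_iff_mem_minpoly_aroots hxQ).2 hy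
        obtain ⟨g, hg⟩ := hc.symm.exists_algEquiv
        exact ⟨g, by rw [hg]; rfl⟩
      · rintro ⟨g, rfl⟩
        refine ⟨minpoly.ne_zero hxQ, ?_⟩
        rw [← hιx, ← minpoly.algEquiv_eq g x, Polynomial.aeval_algHom_apply, minpoly.aeval, map_zero]
    · apply Polynomial.nodup_roots
      apply Polynomial.Separable.map
      rw [hmin]
      exact IsGalois.separable ℚ x
  rw [mahlerM, intMinpoly_lc _ hIsInt, intMinpoly_roots _ hQ, hroots]
  have : (Multiset.map (fun z : ℂ => max 1 ‖z‖)
    ((Finset.univ.image (fun g : L ≃ₐ[ℚ] L => r (g x))).image (fun t : ℝ => (t : ℂ))).val).prod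
    = ∏ z ∈ (Finset.univ.image (fun g : L ≃ₐ[ℚ] L => r (g x))).image (fun t : ℝ => (t : ℂ)),
      max 1 ‖z‖ := rfl
  rw [this, Finset.prod_image (by intro a _ b _ h; exact Complex.ofReal_injective h)]
  simp

lemma mahlerM_eq_prod (r : L →+* ℝ) (x : L) (hx : IsIntegral ℤ x)
    (hs : ∀ g : L ≃ₐ[ℚ] L, g x = x → g = 1) :
    mahlerM ((r x : ℝ) : ℂ) = ∏ g : L ≃ₐ[ℚ] L, max 1 |r (g x)| := by
  classical
  rw [mahlerM_eq_prod_image r x hx, Finset.prod_image]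
  intro a _ b _ h
  have h1 : a x = b x := r.injective h
  have h2 : (b⁻¹ * a) x = x := by
    rw [AlgEquiv.mul_apply, h1, ← AlgEquiv.mul_apply]; simp
  have := hs _ h2
  rw [inv_mul_eq_one] at this
  exact this.symm

open Classical in
lemma mahler_step (r : L →+* ℝ) (x : L) (hx : IsIntegral ℤ x)
    (hs : ∀ g : L ≃ₐ[ℚ] L, g x = x → g = 1) :
    ∃ s : L, (s = 1 ∨ s = -1) ∧
      mahlerC ((r x : ℝ) : ℂ) =
        ((r (s * ∏ g : L ≃ₐ[ℚ] L with 1 < |r (g x)|, g x) : ℝ) : ℂ) ∧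
      r (s * ∏ g : L ≃ₐ[ℚ] L with 1 < |r (g x)|, g x) =
        ∏ g : L ≃ₐ[ℚ] L with 1 < |r (g x)|, |r (g x)| := by
  have h1 : mahlerM ((r x : ℝ) : ℂ) = ∏ g : L ≃ₐ[ℚ] L with 1 < |r (g x)|, |r (g x)| := by
    rw [mahlerM_eq_prod r x hx hs, Finset.prod_filter]
    apply Finset.prod_congr rfl
    intro g _
    split_ifs with h
    · exact max_eq_right h.le
    · exact max_eq_left (not_lt.1 h)
  have h2 : |r (∏ g : L ≃ₐ[ℚ] L with 1 < |r (g x)|, g x)| =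
      ∏ g : L ≃ₐ[ℚ] L with 1 < |r (g x)|, |r (g x)| := by
    rw [map_prod, Finset.abs_prod]
  rcases abs_choice (r (∏ g : L ≃ₐ[ℚ] L with 1 < |r (g x)|, g x)) with h | h
  · refine ⟨1, Or.inl rfl, ?_, ?_⟩
    · rw [mahlerC, h1, one_mul, ← h, h2]
    · rw [one_mul, ← h, h2]
  · refine ⟨-1, Or.inr rfl, ?_, ?_⟩
    · rw [mahlerC, h1, neg_one_mul, map_neg, ← h, h2]
    · rw [neg_one_mul, map_neg, ← h, h2]

lemma isIntegral_conj (x : L) (hx : IsIntegral ℤ x) (g : L ≃ₐ[ℚ] L) : IsIntegral ℤ (g x) :=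
  hx.map ((g : L →+* L).toIntAlgHom)

lemma isIntegral_sign (s : L) (hs : s = 1 ∨ s = -1) : IsIntegral ℤ s := by
  rcases hs with rfl | rfl
  · exact isIntegral_one
  · exact isIntegral_one.neg

lemma mahler_fixed (r : L →+* ℝ) (x : L) (hx : IsIntegral ℤ x) (h1 : 1 ≤ r x)
    (h : ∀ g : L ≃ₐ[ℚ] L, g x = x ∨ |r (g x)| ≤ 1) :
    mahlerC ((r x : ℝ) : ℂ) = ((r x : ℝ) : ℂ) := by
  classical
  rw [mahlerC, mahlerM_eq_prod_image r x hx, Finset.prod_eq_single (r x)]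
  · rw [abs_of_nonneg (by linarith), max_eq_right h1]
  · intro z hz hne
    simp only [Finset.mem_image, Finset.mem_univ, true_and] at hz
    obtain ⟨g, rfl⟩ := hz
    rcases h g with h | h
    · rw [h] at hne; exact absurd rfl hne
    · exact max_eq_left h
  · intro h'
    exact absurd (Finset.mem_image.2 ⟨1, Finset.mem_univ _, rfl⟩) h'

def PrePer (z : ℂ) : Prop := (Set.range fun m : ℕ => mahlerC^[m] z).Finite

lemma PrePer.of_fixed {z : ℂ} (h : mahlerC z = z) : PrePer z := by
  apply (Set.finite_singleton z).subset
  rintro _ ⟨m, rfl⟩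
  exact Function.iterate_fixed h m

lemma PrePer.of_next {z : ℂ} (h : PrePer (mahlerC z)) : PrePer z := by
  apply (h.union (Set.finite_singleton z)).subset
  rintro _ ⟨m, rfl⟩
  rcases m with _ | m
  · right; rfl
  · left; exact ⟨m, by simp⟩

/-- log vector -/
noncomputable def lvec (r : L →+* ℝ) {H : Type*} [AddCommGroup H]
    (e : Multiplicative H ≃* (L ≃ₐ[ℚ] L)) (x : L) (h : H) : ℝ :=
  Real.log |r (e (Multiplicative.ofAdd h) x)|

open Classical in
noncomputable def Tmap {H : Type*} [AddCommGroup H] [Fintype H] (f : H → ℝ) (h : H) : ℝ :=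
  ∑ g : H with 0 < f g, f (h + g)

lemma conj_pos (r : L →+* ℝ) {x : L} (hx0 : x ≠ 0) (g : L ≃ₐ[ℚ] L) : 0 < |r (g x)| := by
  rw [abs_pos]
  intro h
  rw [map_eq_zero] at h
  exact hx0 (by simpa using h)

open Classical in
lemma lvec_step (r : L →+* ℝ) {H : Type*} [AddCommGroup H] [Fintype H]
    (e : Multiplicative H ≃* (L ≃ₐ[ℚ] L)) (x : L) (hx0 : x ≠ 0) (s : L) (hs : s = 1 ∨ s = -1) :
    lvec r e (s * ∏ g : L ≃ₐ[ℚ] L with 1 < |r (g x)|, g x) = Tmap (lvec r e x) := by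
  funext h
  have hs1 : |r (e (Multiplicative.ofAdd h) s)| = 1 := by
    rcases hs with rfl | rfl <;> simp
  rw [lvec, map_mul, map_mul, abs_mul, hs1, one_mul, map_prod, map_prod, Finset.abs_prod,
    Real.log_prod (by
      intro g _
      exact (conj_pos r (x := g x) (by simpa using hx0) _).ne'), Tmap]
  rw [Finset.sum_filter, Finset.sum_filter]
  refine Fintype.sum_equiv (e.symm.toEquiv.trans Multiplicative.toAdd) _ _ ?_
  intro g
  have : e (Multiplicative.ofAdd (Multiplicative.toAdd (e.symm g))) = g := by simp
  simp only [lvec, Equiv.trans_apply, MulEquiv.toEquiv_eq_coe, EquivLike.coe_coe, this, ofAdd_add, map_mul]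
  have h2 : (0 < Real.log |r (g x)|) ↔ 1 < |r (g x)| := Real.log_pos_iff (abs_nonneg _)
  simp only [h2, AlgEquiv.mul_apply]

lemma wander (r : L →+* ℝ) {H : Type*} [AddCommGroup H] [Fintype H]
    (e : Multiplicative H ≃* (L ≃ₐ[ℚ] L)) (Q : (H → ℝ) → Prop)
    (hQ : ∀ f, Q f → 0 < f 0 ∧ (∀ h ≠ 0, f h ≠ f 0) ∧ (∃ h ≠ 0, 0 < f h) ∧ Q (Tmap f))
    (x : L) (hx : IsIntegral ℤ x) (hx0 : x ≠ 0) (hQx : Q (lvec r e x)) :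
    (Set.range fun m : ℕ => mahlerC^[m] ((r x : ℝ) : ℂ)).Infinite := by
  classical
  have step : ∀ y : {y : L // IsIntegral ℤ y ∧ y ≠ 0 ∧ Q (lvec r e y)},
      ∃ z : {y : L // IsIntegral ℤ y ∧ y ≠ 0 ∧ Q (lvec r e y)},
        mahlerC ((r y.1 : ℝ) : ℂ) = ((r z.1 : ℝ) : ℂ) ∧ |r y.1| < |r z.1| := by
    rintro ⟨y, hy, hy0, hQy⟩
    obtain ⟨q1, q2, ⟨k, hk0, hk⟩, q4⟩ := hQ _ hQy
    have hstab : ∀ g : L ≃ₐ[ℚ] L, g y = y → g = 1 := by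
      intro g hg
      by_contra hne
      apply q2 (Multiplicative.toAdd (e.symm g))
      · intro h0
        apply hne
        have : e.symm g = 1 := h0
        simpa using this
      · simp [lvec, hg]
    obtain ⟨s, hs, h1, h2⟩ := mahler_step r y hy hstab
    refine ⟨⟨_, ?_, ?_, ?_⟩, h1, ?_⟩
    · exact (isIntegral_sign s hs).mul (IsIntegral.prod _ fun g _ => isIntegral_conj y hy g)
    · apply mul_ne_zero
      · rcases hs with rfl | rfl <;> simp
      · rw [Finset.prod_ne_zero_iff]; intro g _; simpa using hy0
    · rw [lvec_step r e y hy0 s hs]; exact q4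
    · rw [h2]
      have hlog : ∀ g : L ≃ₐ[ℚ] L, 1 < |r (g y)| ↔ 0 < Real.log |r (g y)| :=
        fun g => (Real.log_pos_iff (abs_nonneg _)).symm
      have m1 : (1 : L ≃ₐ[ℚ] L) ∈ Finset.univ.filter (fun g : L ≃ₐ[ℚ] L => 1 < |r (g y)|) := by
        simp only [Finset.mem_filter, Finset.mem_univ, true_and, hlog]
        simpa [lvec] using q1
      have mk : e (Multiplicative.ofAdd k) ∈
          (Finset.univ.filter (fun g : L ≃ₐ[ℚ] L => 1 < |r (g y)|)).erase 1 := by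
        simp only [Finset.mem_erase, Finset.mem_filter, Finset.mem_univ, true_and, hlog]
        refine ⟨?_, hk⟩
        intro h
        apply hk0
        have : Multiplicative.ofAdd k = 1 := by simpa using h
        simpa using this
      refine lt_of_lt_of_le ?_ (le_abs_self _)
      rw [← Finset.mul_prod_erase _ _ m1, ← Finset.mul_prod_erase _ _ mk]
      have p1 : 0 < |r y| := conj_pos r hy0 1
      have p2 : 1 < |r (e (Multiplicative.ofAdd k) y)| := (hlog _).2 hk
      have p3 : 1 ≤ ∏ g ∈ ((Finset.univ.filter (fun g : L ≃ₐ[ℚ] L => 1 < |r (g y)|)).erase 1).erase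
          (e (Multiplicative.ofAdd k)), |r (g y)| := by
        apply one_le_prod_real
        intro g hg
        have := (Finset.mem_filter.1 (Finset.mem_of_mem_erase (Finset.mem_of_mem_erase hg))).2
        exact this.le
      rw [AlgEquiv.one_apply]
      nlinarith [mul_le_mul_of_nonneg_left p3 (by linarith : 0 ≤ |r (e (Multiplicative.ofAdd k) y)|)]
  choose next hn1 hn2 using step
  let x0 : {y : L // IsIntegral ℤ y ∧ y ≠ 0 ∧ Q (lvec r e y)} := ⟨x, hx, hx0, hQx⟩
  have hit : ∀ m : ℕ, mahlerC^[m] ((r x : ℝ) : ℂ) = ((r (next^[m] x0).1 : ℝ) : ℂ) := by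
    intro m
    induction m with
    | zero => rfl
    | succ m ih => rw [Function.iterate_succ_apply', ih, hn1, Function.iterate_succ_apply']
  have hmono : StrictMono (fun m : ℕ => |r (next^[m] x0).1|) := by
    apply strictMono_nat_of_lt_succ
    intro m
    rw [Function.iterate_succ_apply']
    exact hn2 _
  apply Set.infinite_range_of_injective
  intro a b hab
  apply hmono.injective
  simp only [hit] at hab
  have : r (next^[a] x0).1 = r (next^[b] x0).1 := by exact_mod_cast hab
  simp [this]

end Lfield

set_option linter.unusedSectionVars false

section Small
variable {L : Type*} [Field L] [NumberField L] [IsGalois ℚ L]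

lemma prePer_of_fixed (r : L →+* ℝ) (y : L) (hy : IsIntegral ℤ y) (h1 : 1 ≤ r y)
    (h : ∀ g : L ≃ₐ[ℚ] L, g y = y ∨ |r (g y)| ≤ 1) : PrePer ((r y : ℝ) : ℂ) :=
  PrePer.of_fixed (mahler_fixed r y hy h1 h)

lemma map_sign (s : L) (hs : s = 1 ∨ s = -1) (g : L ≃ₐ[ℚ] L) : g s = s := by
  rcases hs with rfl | rfl <;> simp

lemma prePer_of_two (r : L →+* ℝ) (y z : L) (hy : IsIntegral ℤ y) (h1 : 1 ≤ r y)
    (h : ∀ g : L ≃ₐ[ℚ] L, g y = y ∨ g y = z) : PrePer ((r y : ℝ) : ℂ) := by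
  classical
  by_cases hall : ∀ g : L ≃ₐ[ℚ] L, g y = y
  · exact prePer_of_fixed r y hy h1 fun g => Or.inl (hall g)
  push Not at hall
  obtain ⟨g0, hg0⟩ := hall
  have hz : g0 y = z := (h g0).resolve_left hg0
  have hzy : z ≠ y := hz ▸ hg0
  by_cases hz1 : |r z| ≤ 1
  · refine prePer_of_fixed r y hy h1 fun g => ?_
    rcases h g with h | h
    · exact Or.inl h
    · right; rwa [h]
  push Not at hz1
  have him : Finset.univ.image (fun g : L ≃ₐ[ℚ] L => r (g y)) = {r y, r z} := by
    ext t
    simp only [Finset.mem_image, Finset.mem_univ, true_and, Finset.mem_insert,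
      Finset.mem_singleton]
    constructor
    · rintro ⟨g, rfl⟩
      rcases h g with h | h <;> simp [h]
    · rintro (rfl | rfl)
      · exact ⟨1, rfl⟩
      · exact ⟨g0, by rw [hz]⟩
  have hM : mahlerM ((r y : ℝ) : ℂ) = r y * |r z| := by
    rw [mahlerM_eq_prod_image r y hy, him, Finset.prod_pair (fun h => hzy (r.injective h).symm),
      abs_of_nonneg (by linarith), max_eq_right h1, max_eq_right hz1.le]
  obtain ⟨s, hs, hsz⟩ : ∃ s : L, (s = 1 ∨ s = -1) ∧ r (s * z) = |r z| := by
    rcases abs_choice (r z) with h | h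
    · exact ⟨1, Or.inl rfl, by rw [one_mul, h]⟩
    · exact ⟨-1, Or.inr rfl, by rw [neg_one_mul, map_neg, h]⟩
  have hw : r (y * (s * z)) = r y * |r z| := by rw [map_mul, hsz]
  apply PrePer.of_next
  rw [mahlerC, hM, ← hw]
  have hzi : IsIntegral ℤ z := hz ▸ isIntegral_conj y hy g0
  apply prePer_of_fixed r _ (hy.mul ((isIntegral_sign s hs).mul hzi))
  · rw [hw]; nlinarith
  · intro g
    left
    rw [map_mul, map_mul, map_sign s hs]
    have a1 := h g
    have a2 := h (g * g0)
    rw [AlgEquiv.mul_apply, hz] at a2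
    have a3 : g z ≠ g y := fun h => hzy (g.injective h)
    rcases a1 with a1 | a1 <;> rcases a2 with a2 | a2
    · rw [a1, a2] at a3; exact absurd rfl a3
    · rw [a1, a2]
    · rw [a1, a2]; ring
    · rw [a1, a2] at a3; exact absurd rfl a3

lemma conj_prod_univ (x : L) (g : L ≃ₐ[ℚ] L) :
    g (∏ h : L ≃ₐ[ℚ] L, h x) = ∏ h : L ≃ₐ[ℚ] L, h x := by
  rw [map_prod]
  exact Fintype.prod_equiv (Equiv.mulLeft g) _ _ (fun h => rfl)

open Classical in
lemma prePer_easy (r : L →+* ℝ)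
    (hG : Nat.card (L ≃ₐ[ℚ] L) = 3 ∨
      (Nat.card (L ≃ₐ[ℚ] L) = 4 ∧ ∀ g : L ≃ₐ[ℚ] L, g * g = 1))
    (x : L) (hx : IsIntegral ℤ x) (h1 : 1 ≤ r x)
    (hs : ∀ g : L ≃ₐ[ℚ] L, g x = x → g = 1)
    (hB : (Finset.univ.filter (fun g : L ≃ₐ[ℚ] L => ¬ 1 < |r (g x)|)).card ≠ 1) :
    PrePer ((r x : ℝ) : ℂ) := by
  by_cases hA : ∀ g : L ≃ₐ[ℚ] L, 1 < |r (g x)| → g = 1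
  · refine prePer_of_fixed r x hx h1 fun g => ?_
    by_cases hg : 1 < |r (g x)|
    · left; rw [hA g hg]; rfl
    · right; exact not_lt.1 hg
  push Not at hA
  obtain ⟨g, hg, hg1⟩ := hA
  have h1A : 1 < |r ((1 : L ≃ₐ[ℚ] L) x)| := by
    rw [AlgEquiv.one_apply, abs_of_nonneg (by linarith)]
    refine lt_of_le_of_ne h1 ?_
    intro h
    have : x = 1 := r.injective (by rw [← h, map_one])
    exact hg1 (hs g (by rw [this, map_one]))
  have hcard := Finset.card_filter_add_card_filter_not (s := (Finset.univ : Finset (L ≃ₐ[ℚ] L)))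
    (fun g : L ≃ₐ[ℚ] L => 1 < |r (g x)|)
  rw [Finset.card_univ, ← Nat.card_eq_fintype_card] at hcard
  have hsub : {1, g} ⊆ Finset.univ.filter (fun g : L ≃ₐ[ℚ] L => 1 < |r (g x)|) := by
    intro h hh
    simp only [Finset.mem_insert, Finset.mem_singleton] at hh
    rcases hh with rfl | rfl <;> simp_all
  have hc2 : ({1, g} : Finset (L ≃ₐ[ℚ] L)).card = 2 := Finset.card_pair hg1.symm
  have hle := Finset.card_le_card hsub
  obtain ⟨s, hss, hM, hpos⟩ := mahler_step r x hx hs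
  have hge : 1 ≤ r (s * ∏ g : L ≃ₐ[ℚ] L with 1 < |r (g x)|, g x) := by
    rw [hpos]
    apply one_le_prod_real
    intro i hi
    exact (Finset.mem_filter.1 hi).2.le
  have hIsInt : IsIntegral ℤ (s * ∏ g : L ≃ₐ[ℚ] L with 1 < |r (g x)|, g x) :=
    (isIntegral_sign s hss).mul (IsIntegral.prod _ fun g _ => isIntegral_conj x hx g)
  apply PrePer.of_next
  rw [hM]
  by_cases hB0 : (Finset.univ.filter (fun g : L ≃ₐ[ℚ] L => ¬ 1 < |r (g x)|)).card = 0
  · have hAu : Finset.univ.filter (fun g : L ≃ₐ[ℚ] L => 1 < |r (g x)|) = Finset.univ := by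
      rw [← Finset.card_eq_iff_eq_univ, ← Nat.card_eq_fintype_card]; omega
    apply prePer_of_fixed r _ hIsInt hge
    intro k
    left
    rw [hAu, map_mul, map_sign s hss, conj_prod_univ]
  · rcases hG with hG | ⟨hG, hex⟩
    · omega
    have hAe : Finset.univ.filter (fun g : L ≃ₐ[ℚ] L => 1 < |r (g x)|) = {1, g} :=
      (Finset.eq_of_subset_of_card_le hsub (by omega)).symm
    rw [hAe] at hge hIsInt ⊢
    set w := s * ∏ g ∈ ({1, g} : Finset (L ≃ₐ[ℚ] L)), g x with hw
    have hww : w = s * (x * g x) := by rw [hw, Finset.prod_pair hg1.symm]; rfl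
    have hgw : g w = w := by
      rw [hww, map_mul, map_mul, map_sign s hss, ← AlgEquiv.mul_apply, hex, AlgEquiv.one_apply,
        mul_comm (g x)]
    obtain ⟨h0, hh0⟩ : ∃ h0 : L ≃ₐ[ℚ] L, h0 ∉ ({1, g} : Finset (L ≃ₐ[ℚ] L)) := by
      by_contra hcon
      push Not at hcon
      have := Finset.eq_univ_iff_forall.2 hcon
      rw [← Finset.card_eq_iff_eq_univ, ← Nat.card_eq_fintype_card] at this
      omega
    simp only [Finset.mem_insert, Finset.mem_singleton, not_or] at hh0
    have hall : ({1, g, h0, h0 * g} : Finset (L ≃ₐ[ℚ] L)) = Finset.univ := by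
      rw [← Finset.card_eq_iff_eq_univ, ← Nat.card_eq_fintype_card, hG]
      rw [Finset.card_insert_of_notMem, Finset.card_insert_of_notMem, Finset.card_pair]
      · intro h; exact hg1 (by simpa using h)
      · simp only [Finset.mem_insert, Finset.mem_singleton, not_or]
        refine ⟨Ne.symm hh0.2, fun h => hh0.1 ?_⟩
        simpa using h
      · simp only [Finset.mem_insert, Finset.mem_singleton, not_or]
        refine ⟨Ne.symm hg1, Ne.symm hh0.1, fun h => hh0.2 ?_⟩
        have h2 : h0 * g = g * g := by rw [hex, ← h]
        exact mul_right_cancel h2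
    apply prePer_of_two r w (h0 w) hIsInt hge
    intro k
    have hk : k ∈ ({1, g, h0, h0 * g} : Finset (L ≃ₐ[ℚ] L)) := by rw [hall]; exact Finset.mem_univ _
    simp only [Finset.mem_insert, Finset.mem_singleton] at hk
    rcases hk with rfl | rfl | rfl | rfl
    · left; rfl
    · left; exact hgw
    · right; rfl
    · right; rw [AlgEquiv.mul_apply, hgw]

open Classical in
lemma mahler_drop (r : L →+* ℝ) (x : L) (hx : IsIntegral ℤ x) (hx0 : x ≠ 0)
    (hs : ∀ g : L ≃ₐ[ℚ] L, g x = x → g = 1)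
    (hB : (Finset.univ.filter (fun g : L ≃ₐ[ℚ] L => ¬ 1 < |r (g x)|)).card = 1) :
    ∃ (y : L) (c : L ≃ₐ[ℚ] L), IsIntegral ℤ y ∧ y ≠ 0 ∧ (∀ g : L ≃ₐ[ℚ] L, g y = y → g = 1) ∧
      1 ≤ r y ∧ mahlerC ((r x : ℝ) : ℂ) = ((r y : ℝ) : ℂ) ∧
      (∀ g : L ≃ₐ[ℚ] L, |r (g y)| * |r (g (c x))| = ∏ h : L ≃ₐ[ℚ] L, |r (h x)|) ∧
      (∀ g : L ≃ₐ[ℚ] L, g ≠ c → 1 < |r (g x)|) := by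
  obtain ⟨c, hc⟩ := Finset.card_eq_one.1 hB
  obtain ⟨s, hss, hM, hpos⟩ := mahler_step r x hx hs
  have hAe : Finset.univ.filter (fun g : L ≃ₐ[ℚ] L => 1 < |r (g x)|) = Finset.univ.erase c := by
    ext g
    have := Finset.ext_iff.1 hc g
    simp only [Finset.mem_filter, Finset.mem_univ, true_and, Finset.mem_singleton,
      Finset.mem_erase, and_true] at this ⊢
    rw [Ne, ← this, not_not]
  have hge : 1 ≤ r (s * ∏ g : L ≃ₐ[ℚ] L with 1 < |r (g x)|, g x) := by
    rw [hpos]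
    apply one_le_prod_real
    intro i hi
    exact (Finset.mem_filter.1 hi).2.le
  have hIsInt : IsIntegral ℤ (s * ∏ g : L ≃ₐ[ℚ] L with 1 < |r (g x)|, g x) :=
    (isIntegral_sign s hss).mul (IsIntegral.prod _ fun g _ => isIntegral_conj x hx g)
  rw [hAe] at hge hIsInt hM
  set y := s * ∏ g ∈ Finset.univ.erase c, g x with hy
  have hyc : y * c x = s * ∏ g : L ≃ₐ[ℚ] L, g x := by
    rw [hy, mul_assoc, Finset.prod_erase_mul _ _ (Finset.mem_univ c)]
  have hg : ∀ g : L ≃ₐ[ℚ] L, g y * g (c x) = s * ∏ g : L ≃ₐ[ℚ] L, g x := by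
    intro g
    rw [← map_mul, hyc, map_mul, map_sign s hss, conj_prod_univ]
  have hy0 : y ≠ 0 := by
    intro h; rw [h, map_zero] at hge; linarith
  refine ⟨y, c, hIsInt, hy0, ?_, hge, hM, ?_, ?_⟩
  · intro g hgy
    have h1 := hg g
    rw [hgy, ← hyc] at h1
    have h2 := mul_left_cancel₀ hy0 h1
    have h3 : (c⁻¹ * (g * c)) x = x := by
      rw [AlgEquiv.mul_apply, AlgEquiv.mul_apply, h2, ← AlgEquiv.mul_apply]; simp
    have h4 := hs _ h3
    rw [inv_mul_eq_one] at h4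
    simpa using h4
  · intro g
    rw [← abs_mul, ← map_mul, hg, map_mul, abs_mul, map_prod, Finset.abs_prod]
    rcases hss with rfl | rfl <;> simp
  · intro g hgc
    have : g ∈ Finset.univ.filter (fun g : L ≃ₐ[ℚ] L => 1 < |r (g x)|) := by
      rw [hAe]; simp [hgc]
    exact (Finset.mem_filter.1 this).2

lemma abs_norm_int (r : L →+* ℝ) (x : L) (hx : IsIntegral ℤ x) (hx0 : x ≠ 0) :
    ∃ N : ℕ, 1 ≤ N ∧ ∏ h : L ≃ₐ[ℚ] L, |r (h x)| = N := by
  have h1 : ∏ h : L ≃ₐ[ℚ] L, h x = algebraMap ℚ L (Algebra.norm ℚ x) := by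
    rw [Algebra.norm_eq_prod_automorphisms]
  have h2 : IsIntegral ℤ (Algebra.norm ℚ x) := Algebra.isIntegral_norm ℚ hx
  obtain ⟨m, hm⟩ := IsIntegrallyClosed.isIntegral_iff.1 h2
  have h3 : ∏ h : L ≃ₐ[ℚ] L, |r (h x)| = |(m : ℝ)| := by
    rw [← Finset.abs_prod, ← map_prod, h1, ← hm]
    simp
  refine ⟨m.natAbs, ?_, ?_⟩
  · rw [Nat.one_le_iff_ne_zero, Int.natAbs_ne_zero]
    rintro rfl
    have : ∏ h : L ≃ₐ[ℚ] L, |r (h x)| ≠ 0 :=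
      Finset.prod_ne_zero_iff.2 fun g _ => (conj_pos r hx0 g).ne'
    apply this
    rw [h3]; simp
  · rw [h3, Nat.cast_natAbs, Int.cast_abs]

lemma prePer_main (r : L →+* ℝ)
    (hG : Nat.card (L ≃ₐ[ℚ] L) = 3 ∨
      (Nat.card (L ≃ₐ[ℚ] L) = 4 ∧ ∀ g : L ≃ₐ[ℚ] L, g * g = 1)) (k : ℕ) :
    ∀ (x : L) (_ : IsIntegral ℤ x) (_ : 1 ≤ r x)
    (_ : ∀ g : L ≃ₐ[ℚ] L, g x = x → g = 1) (_ : ∀ g : L ≃ₐ[ℚ] L, 1 < 2 ^ k * |r (g x)|),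
    PrePer ((r x : ℝ) : ℂ) := by
  classical
  induction k with
  | zero =>
    intro x hx h1 hs h2
    apply prePer_easy r hG x hx h1 hs
    rw [Finset.filter_false_of_mem]
    · simp
    · intro g _; have := h2 g; simpa using this
  | succ k ih =>
    intro x hx h1 hs h2
    have hx0 : x ≠ 0 := by
      intro h; rw [h, map_zero] at h1; linarith
    by_cases hB : (Finset.univ.filter (fun g : L ≃ₐ[ℚ] L => ¬ 1 < |r (g x)|)).card ≠ 1
    · exact prePer_easy r hG x hx h1 hs hB
    push Not at hB
    obtain ⟨y, c, hy, hy0, hys, hy1, hyM, hyg, hxc⟩ := mahler_drop r x hx hx0 hs (by simpa using hB)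
    apply PrePer.of_next
    rw [hyM]
    by_cases hBy : (Finset.univ.filter (fun g : L ≃ₐ[ℚ] L => ¬ 1 < |r (g y)|)).card ≠ 1
    · exact prePer_easy r hG y hy hy1 hys hBy
    push Not at hBy
    have hBy' : (Finset.univ.filter (fun g : L ≃ₐ[ℚ] L => ¬ 1 < |r (g y)|)).card = 1 := by
      simpa using hBy
    obtain ⟨z, d, hz, hz0, hzs, hz1, hzM, hzg, hyd⟩ := mahler_drop r y hy hy0 hys hBy'
    apply PrePer.of_next
    rw [hzM]
    obtain ⟨N, hN1, hN⟩ := abs_norm_int r x hx hx0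
    rw [hN] at hyg
    set n := Nat.card (L ≃ₐ[ℚ] L) with hn
    have hn3 : 3 ≤ n := by omega
    have hN2 : 2 ≤ N := by
      by_contra hlt
      have hN1' : N = 1 := by omega
      rw [hN1'] at hyg
      -- find two elements different from 1, one of them different from d
      obtain ⟨g, hg⟩ : ∃ g : L ≃ₐ[ℚ] L, g ∉ ({1, d} : Finset (L ≃ₐ[ℚ] L)) := by
        by_contra hcon
        push Not at hcon
        have h3 := Finset.eq_univ_iff_forall.2 hcon
        rw [← Finset.card_eq_iff_eq_univ, ← Nat.card_eq_fintype_card] at h3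
        have := Finset.card_le_two (a := (1 : L ≃ₐ[ℚ] L)) (b := d)
        omega
      simp only [Finset.mem_insert, Finset.mem_singleton, not_or] at hg
      have a1 := hyd g hg.2
      have a2 := hxc (g * c) (by simpa using hg.1)
      have a3 := hyg g
      rw [AlgEquiv.mul_apply] at a2
      push_cast at a3
      nlinarith
    have hNpos : (0 : ℝ) < N := by positivity
    have hNy : (∏ h : L ≃ₐ[ℚ] L, |r (h y)|) * N = (N : ℝ) ^ n := by
      have e1 : ∏ h : L ≃ₐ[ℚ] L, |r (h (c x))| = N := by
        rw [← hN]
        exact Fintype.prod_equiv (Equiv.mulRight c) _ _ (fun h => rfl)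
      conv_lhs => rw [← e1]
      rw [← Finset.prod_mul_distrib, Finset.prod_congr rfl (fun g _ => hyg g), Finset.prod_const,
        Finset.card_univ, ← Nat.card_eq_fintype_card]
    apply ih z hz hz1 hzs
    intro g
    have b1 := hzg g
    have b2 := hyg (g * d)
    simp only [AlgEquiv.mul_apply] at b2
    have b3 := h2 (g * d * c)
    simp only [AlgEquiv.mul_apply] at b3
    have p1 : 0 < |r (g (d y))| := conj_pos r (x := d y) (by simpa using hy0) g
    have p2 : 0 < |r (g z)| := conj_pos r hz0 g
    set u := |r (g (d (c x)))| with hu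
    set v := |r (g (d y))| with hv
    set w := |r (g z)| with hw
    -- w * v * N = N^n, v * u = N, hence w * N^2 = N^n u
    have hw2 : w * (N * N) = (N : ℝ) ^ n * u := by
      rw [← hNy, ← b1]
      calc w * (N * N) = w * N * (v * u) := by rw [b2]; ring
        _ = _ := by ring
    have hu0 : 0 < u := by
      have : 0 < u * v := by rw [mul_comm, b2]; exact hNpos
      exact pos_of_mul_pos_left this p1.le
    have hw3 : 2 * u ≤ w := by
      have e3 : (N : ℝ) ^ n = N * N * (N : ℝ) ^ (n - 2) := by
        rw [← pow_two, ← pow_add]; congr 1; omega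
      have e4 : w = (N : ℝ) ^ (n - 2) * u := by
        have hNN : (N * N : ℝ) ≠ 0 := by positivity
        apply mul_right_cancel₀ hNN
        rw [hw2, e3]; ring
      have e5 : (2 : ℝ) ≤ (N : ℝ) ^ (n - 2) := by
        have h2N : (2 : ℝ) ≤ N := by exact_mod_cast hN2
        calc (2 : ℝ) ≤ N := h2N
          _ = (N : ℝ) ^ 1 := (pow_one _).symm
          _ ≤ (N : ℝ) ^ (n - 2) := pow_le_pow_right₀ (by linarith) (by omega)
      rw [e4]
      exact mul_le_mul_of_nonneg_right e5 hu0.le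
    have : (0 : ℝ) < 2 ^ k := by positivity
    rw [pow_succ] at b3
    nlinarith

lemma prePer_small (r : L →+* ℝ)
    (hG : Nat.card (L ≃ₐ[ℚ] L) = 1 ∨ Nat.card (L ≃ₐ[ℚ] L) = 2 ∨ Nat.card (L ≃ₐ[ℚ] L) = 3 ∨
      (Nat.card (L ≃ₐ[ℚ] L) = 4 ∧ ∀ g : L ≃ₐ[ℚ] L, g * g = 1))
    (x : L) (hx : IsIntegral ℤ x) (h1 : 1 ≤ r x) : PrePer ((r x : ℝ) : ℂ) := by
  classical
  have two : ∀ z w : L ≃ₐ[ℚ] L, (∀ g : L ≃ₐ[ℚ] L, g = 1 ∨ g = w) → PrePer ((r x : ℝ) : ℂ) := by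
    intro _ w hw
    apply prePer_of_two r x (w x) hx h1
    intro g
    rcases hw g with rfl | rfl
    · left; rfl
    · right; rfl
  rcases hG with hG | hG | hG
  · have := (Nat.card_eq_one_iff_unique.1 hG).1
    exact two 1 1 fun g => Or.inl (Subsingleton.elim _ _)
  · obtain ⟨w, hw1, hw⟩ := (Nat.card_eq_two_iff' (1 : L ≃ₐ[ℚ] L)).1 hG
    refine two 1 w fun g => ?_
    by_cases hg : g = 1
    · exact Or.inl hg
    · exact Or.inr (hw g hg)
  have hx0 : x ≠ 0 := by
    intro h; rw [h, map_zero] at h1; linarith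
  by_cases hs : ∀ g : L ≃ₐ[ℚ] L, g x = x → g = 1
  · obtain ⟨k, hk⟩ : ∃ k : ℕ, ∀ g : L ≃ₐ[ℚ] L, 1 < (2 : ℝ) ^ k * |r (g x)| := by
      have : ∀ g : L ≃ₐ[ℚ] L, ∃ k : ℕ, 1 / |r (g x)| < (2 : ℝ) ^ k :=
        fun g => pow_unbounded_of_one_lt _ one_lt_two
      choose k hk using this
      refine ⟨Finset.univ.sup k, fun g => ?_⟩
      have h3 := hk g
      rw [div_lt_iff₀ (conj_pos r hx0 g)] at h3
      refine h3.trans_le (mul_le_mul_of_nonneg_right ?_ (abs_nonneg _))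
      exact pow_le_pow_right₀ one_le_two (Finset.le_sup (Finset.mem_univ g))
    exact prePer_main r hG k x hx h1 hs hk
  push Not at hs
  obtain ⟨g, hgx, hg1⟩ := hs
  -- the orbit of x has at most two elements
  rcases hG with hG | ⟨hG, hex⟩
  · have hall : ∀ h : L ≃ₐ[ℚ] L, h ∈ Subgroup.zpowers g := by
      haveI : Fact (Nat.Prime 3) := ⟨Nat.prime_three⟩
      intro h
      exact mem_zpowers_of_prime_card hG hg1
    apply prePer_of_fixed r x hx h1
    intro h
    left
    have hmem : g ∈ MulAction.stabilizer (L ≃ₐ[ℚ] L) x := hgx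
    have : Subgroup.zpowers g ≤ MulAction.stabilizer (L ≃ₐ[ℚ] L) x := by
      rwa [Subgroup.zpowers_le]
    exact this (hall h)
  · obtain ⟨h0, hh0⟩ : ∃ h0 : L ≃ₐ[ℚ] L, h0 ∉ ({1, g} : Finset (L ≃ₐ[ℚ] L)) := by
      by_contra hcon
      push Not at hcon
      have := Finset.eq_univ_iff_forall.2 hcon
      rw [← Finset.card_eq_iff_eq_univ, ← Nat.card_eq_fintype_card] at this
      have := Finset.card_le_two (a := (1 : L ≃ₐ[ℚ] L)) (b := g)
      omega
    simp only [Finset.mem_insert, Finset.mem_singleton, not_or] at hh0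
    have hall : ({1, g, h0, h0 * g} : Finset (L ≃ₐ[ℚ] L)) = Finset.univ := by
      rw [← Finset.card_eq_iff_eq_univ, ← Nat.card_eq_fintype_card, hG]
      rw [Finset.card_insert_of_notMem, Finset.card_insert_of_notMem, Finset.card_pair]
      · intro h; exact hg1 (by simpa using h)
      · simp only [Finset.mem_insert, Finset.mem_singleton, not_or]
        refine ⟨Ne.symm hh0.2, fun h => hh0.1 ?_⟩
        simpa using h
      · simp only [Finset.mem_insert, Finset.mem_singleton, not_or]
        refine ⟨Ne.symm hg1, Ne.symm hh0.1, fun h => hh0.2 ?_⟩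
        have h2 : h0 * g = g * g := by rw [hex, ← h]
        exact mul_right_cancel h2
    apply prePer_of_two r x (h0 x) hx h1
    intro k
    have hk : k ∈ ({1, g, h0, h0 * g} : Finset (L ≃ₐ[ℚ] L)) := by rw [hall]; exact Finset.mem_univ _
    simp only [Finset.mem_insert, Finset.mem_singleton] at hk
    rcases hk with rfl | rfl | rfl | rfl
    · left; rfl
    · left; exact hgx
    · right; rfl
    · right; rw [AlgEquiv.mul_apply, hgx]

end Small

set_option linter.unusedSectionVars false

section Density
open NumberField NumberField.Units NumberField.Units.dirichletUnitTheorem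
variable {L : Type*} [Field L] [NumberField L] [IsGalois ℚ L]

open Classical in
lemma lattice_dense (v : logSpace L) : ∃ C : ℝ, ∀ t : ℝ, ∃ u : (𝓞 L)ˣ,
    ‖logEmbedding L (Additive.ofMul u) - t • v‖ ≤ C := by
  have hv : v ∈ Submodule.span ℝ (unitLattice L : Set (logSpace L)) := by
    rw [unitLattice_span_eq_top]; trivial
  induction hv using Submodule.span_induction with
  | mem x hx =>
    obtain ⟨u, -, rfl⟩ := hx
    refine ⟨‖logEmbedding L u‖, fun t => ⟨(Additive.toMul u) ^ ⌊t⌋, ?_⟩⟩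
    have h1 : logEmbedding L (Additive.ofMul ((Additive.toMul u) ^ ⌊t⌋)) =
        (⌊t⌋ : ℝ) • logEmbedding L u := by
      rw [ofMul_zpow, ofMul_toMul, map_zsmul, Int.cast_smul_eq_zsmul]
    rw [h1]
    change ‖(⌊t⌋ : ℝ) • logEmbedding L u - t • logEmbedding L u‖ ≤ _
    rw [← sub_smul, norm_smul]
    refine mul_le_of_le_one_left (norm_nonneg _) ?_
    rw [Real.norm_eq_abs, abs_sub_comm, abs_of_nonneg (by linarith [Int.floor_le t])]
    linarith [Int.lt_floor_add_one t]
  | zero => exact ⟨0, fun t => ⟨1, by simp⟩⟩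
  | add x y _ _ hx hy =>
    obtain ⟨C, hC⟩ := hx
    obtain ⟨D, hD⟩ := hy
    refine ⟨C + D, fun t => ?_⟩
    obtain ⟨a, ha⟩ := hC t
    obtain ⟨b, hb⟩ := hD t
    refine ⟨a * b, ?_⟩
    rw [ofMul_mul, map_add, smul_add, add_sub_add_comm]
    exact (norm_add_le _ _).trans (add_le_add ha hb)
  | smul a x _ hx =>
    obtain ⟨C, hC⟩ := hx
    refine ⟨C, fun t => ?_⟩
    obtain ⟨u, hu⟩ := hC (t * a)
    exact ⟨u, by rwa [smul_smul]⟩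

variable {H : Type*} [AddCommGroup H] [Fintype H]

lemma sum_lvec (r : L →+* ℝ) (e : Multiplicative H ≃* (L ≃ₐ[ℚ] L)) (u : (𝓞 L)ˣ) :
    ∑ h, lvec r e (u : L) h = 0 := by
  have hu0 : ((u : 𝓞 L) : L) ≠ 0 := by simp
  have key : ∀ x : L, x ≠ 0 → ∑ h, lvec r e x h = Real.log (∏ g : L ≃ₐ[ℚ] L, |r (g x)|) := by
    intro x hx
    rw [Real.log_prod fun g _ => (conj_pos r hx g).ne']
    exact Fintype.sum_equiv (Multiplicative.ofAdd.trans e.toEquiv) _ _ fun h => rfl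
  obtain ⟨N, hN, hN'⟩ := abs_norm_int r ((u : 𝓞 L) : L) (u : 𝓞 L).2 hu0
  have hi0 : (((u⁻¹ : (𝓞 L)ˣ) : 𝓞 L) : L) ≠ 0 := by simp
  obtain ⟨M, hM, hM'⟩ := abs_norm_int r (((u⁻¹ : (𝓞 L)ˣ) : 𝓞 L) : L) (u⁻¹ : (𝓞 L)ˣ).val.2 hi0
  have hmul : ((u : 𝓞 L) : L) * (((u⁻¹ : (𝓞 L)ˣ) : 𝓞 L) : L) = 1 := by
    rw [← map_mul, ← Units.val_mul, mul_inv_cancel]; simp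
  have h1 : (N : ℝ) * M = 1 := by
    rw [← hN', ← hM', ← Finset.prod_mul_distrib]
    refine Finset.prod_eq_one fun g _ => ?_
    rw [← abs_mul, ← map_mul, ← map_mul, hmul]; simp
  have h2 : N * M = 1 := by exact_mod_cast h1
  have h3 : N = 1 := Nat.eq_one_of_mul_eq_one_right h2
  rw [key _ hu0, hN', h3]; simp

open Classical in
lemma dense_units (r : L →+* ℝ) (e : Multiplicative H ≃* (L ≃ₐ[ℚ] L)) (v : H → ℝ)
    (hv : ∑ h, v h = 0) : ∃ C : ℝ, ∀ t : ℝ, ∃ u : (𝓞 L)ˣ,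
    ∀ h, |lvec r e (u : L) h - t * v h| ≤ C := by
  let φ : H → (L →+* ℂ) := fun h =>
    (Complex.ofRealHom.comp r).comp ((e (Multiplicative.ofAdd h) : L ≃ₐ[ℚ] L) : L →+* L)
  have hφ : Function.Injective φ := by
    intro a b hab
    have : e (Multiplicative.ofAdd a) = e (Multiplicative.ofAdd b) := by
      ext x
      have := RingHom.congr_fun hab x
      exact (Complex.ofRealHom.comp r).injective this
    simpa using this
  have hcard : Fintype.card H = Fintype.card (L →+* ℂ) := by
    rw [NumberField.Embeddings.card, ← IsGalois.card_aut_eq_finrank, ← Nat.card_congr e.toEquiv,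
      Nat.card_eq_fintype_card]
    exact (Fintype.card_multiplicative H).symm
  have hφb : Function.Bijective φ := (Fintype.bijective_iff_injective_and_card _).2 ⟨hφ, hcard⟩
  have hreal : ∀ h, ComplexEmbedding.IsReal (φ h) := by
    intro h
    rw [ComplexEmbedding.isReal_iff]
    ext x
    simp [φ, ComplexEmbedding.conjugate]
  let W : H → InfinitePlace L := fun h => InfinitePlace.mk (φ h)
  have hWx : ∀ h x, W h x = |r (e (Multiplicative.ofAdd h) x)| := by
    intro h x
    simp [W, φ]
  have hWb : Function.Bijective W := by
    constructor
    · intro a b hab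
      rcases InfinitePlace.mk_eq_iff.1 hab with h | h
      · exact hφ h
      · rw [ComplexEmbedding.isReal_iff.1 (hreal a)] at h
        exact hφ h
    · intro w
      obtain ⟨h, hh⟩ := hφb.2 w.embedding
      exact ⟨h, by simp [W, hh]⟩
  let E : H ≃ InfinitePlace L := Equiv.ofBijective W hWb
  obtain ⟨C, hC⟩ := lattice_dense (L := L) (fun w => v (E.symm w.1))
  have hC0 : 0 ≤ C := by
    obtain ⟨u, hu⟩ := hC 0
    exact (norm_nonneg _).trans hu
  refine ⟨Fintype.card H * C, fun t => ?_⟩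
  obtain ⟨u, hu⟩ := hC t
  refine ⟨u, ?_⟩
  have h1 : ∀ h, W h ≠ w₀ → |lvec r e (u : L) h - t * v h| ≤ C := by
    intro h hh
    refine le_trans ?_ ((norm_le_pi_norm _ (⟨W h, hh⟩ : {w : InfinitePlace L // w ≠ w₀})).trans hu)
    have hm : (InfinitePlace.mult (W h)) = 1 := by
      rw [InfinitePlace.mult, if_pos]
      exact ⟨φ h, hreal h, rfl⟩
    have hs : E.symm (W h) = h := E.symm_apply_apply h
    simp only [Pi.sub_apply, Pi.smul_apply, logEmbedding_component, hm, hs, hWx, Real.norm_eq_abs,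
      smul_eq_mul, Nat.cast_one, one_mul]
    rfl
  have hpos : (1 : ℝ) ≤ Fintype.card H := by exact_mod_cast Fintype.card_pos
  have hbig : C ≤ Fintype.card H * C := by nlinarith
  intro h
  by_cases hh : W h = w₀
  · have hsum : ∑ h, (lvec r e (u : L) h - t * v h) = 0 := by
      rw [Finset.sum_sub_distrib, sum_lvec, ← Finset.mul_sum, hv]; simp
    rw [← Finset.add_sum_erase _ _ (Finset.mem_univ h)] at hsum
    rw [eq_neg_of_add_eq_zero_left hsum, abs_neg]
    refine (Finset.abs_sum_le_sum_abs _ _).trans ?_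
    refine (Finset.sum_le_card_nsmul _ _ C ?_).trans ?_
    · intro k hk
      refine h1 k fun hk' => (Finset.ne_of_mem_erase hk) (hWb.1 (hk'.trans hh.symm))
    · rw [nsmul_eq_mul]
      refine mul_le_mul_of_nonneg_right ?_ hC0
      exact_mod_cast (Finset.card_le_univ _)
  · exact (h1 h hh).trans hbig

end Density

set_option linter.unusedSectionVars false

section Cases
open NumberField
variable {L : Type*} [Field L] [NumberField L] [IsGalois ℚ L]
variable {H : Type*} [AddCommGroup H] [Fintype H]

/-- Existence of a wandering unit for a real embedding. -/
def WanderUnit (r : L →+* ℝ) : Prop :=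
  ∃ x : L, x ≠ 0 ∧ IsIntegral ℤ x ∧ IsIntegral ℤ x⁻¹ ∧
    (Set.range fun m : ℕ => mahlerC^[m] ((r x : ℝ) : ℂ)).Infinite

lemma unit_coe_inv (u : (𝓞 L)ˣ) : ((u : 𝓞 L) : L)⁻¹ = (((u⁻¹ : (𝓞 L)ˣ) : 𝓞 L) : L) := by
  rw [inv_eq_iff_eq_inv]
  refine eq_inv_of_mul_eq_one_left ?_
  rw [← map_mul, ← Units.val_mul, mul_inv_cancel]; simp

lemma isIntegral_unit_zpow {y : L} (h1 : IsIntegral ℤ y) (h2 : IsIntegral ℤ y⁻¹) (m : ℤ) :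
    IsIntegral ℤ (y ^ m) := by
  cases m with
  | ofNat k => simpa using h1.pow k
  | negSucc k => rw [zpow_negSucc, ← inv_pow]; exact h2.pow _

lemma conv_unit (r : L →+* ℝ) (e : Multiplicative H ≃* (L ≃ₐ[ℚ] L)) (c : H → ℤ) (w : (𝓞 L)ˣ) :
    ∃ x : L, x ≠ 0 ∧ IsIntegral ℤ x ∧ IsIntegral ℤ x⁻¹ ∧
      ∀ h, lvec r e x h = ∑ g, (c g : ℝ) * lvec r e (w : L) (h + g) := by
  have hw0 : ((w : 𝓞 L) : L) ≠ 0 := by simp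
  have hw1 : IsIntegral ℤ ((w : 𝓞 L) : L) := (w : 𝓞 L).2
  have hw2 : IsIntegral ℤ ((w : 𝓞 L) : L)⁻¹ := by
    rw [unit_coe_inv]; exact (w⁻¹ : (𝓞 L)ˣ).val.2
  have hc : ∀ g, e g ((w : 𝓞 L) : L) ≠ 0 := fun g => by simp
  have hc1 : ∀ g, IsIntegral ℤ (e g ((w : 𝓞 L) : L)) := fun g => isIntegral_conj _ hw1 _
  have hc2 : ∀ g, IsIntegral ℤ (e g ((w : 𝓞 L) : L))⁻¹ := fun g => by
    rw [← map_inv₀]; exact isIntegral_conj _ hw2 _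
  refine ⟨∏ g : H, e (Multiplicative.ofAdd g) ((w : 𝓞 L) : L) ^ c g, ?_, ?_, ?_, ?_⟩
  · exact Finset.prod_ne_zero_iff.2 fun g _ => zpow_ne_zero _ (hc _)
  · exact IsIntegral.prod _ fun g _ => isIntegral_unit_zpow (hc1 _) (hc2 _) _
  · rw [← Finset.prod_inv_distrib]
    refine IsIntegral.prod _ fun g _ => ?_
    rw [← zpow_neg]
    exact isIntegral_unit_zpow (hc1 _) (hc2 _) _
  · intro h
    unfold lvec
    rw [map_prod, map_prod, Finset.abs_prod, Real.log_prod]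
    · refine Finset.sum_congr rfl fun g _ => ?_
      rw [map_zpow₀, map_zpow₀, abs_zpow, Real.log_zpow, ofAdd_add, map_mul]
      rfl
    · intro g _
      rw [map_zpow₀, map_zpow₀, abs_zpow]
      refine zpow_ne_zero _ ?_
      have := conj_pos r hw0 (e (Multiplicative.ofAdd h) * e (Multiplicative.ofAdd g))
      exact this.ne'

open Classical in
lemma tmap_filter (f : H → ℝ) (A : Finset H) (hA : ∀ g, 0 < f g ↔ g ∈ A) (h : H) :
    Tmap f h = ∑ g ∈ A, f (h + g) := by
  unfold Tmap
  refine Finset.sum_congr ?_ fun _ _ => rfl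
  ext g; simp [hA]

lemma wander_integral [DecidableEq H] (r : L →+* ℝ) (e : Multiplicative H ≃* (L ≃ₐ[ℚ] L))
    (c : H → ℤ) (n : ℕ) (hn : 0 < n)
    (h1 : ∀ m, ∑ g, c g * c (m - g) = n * c m)
    (h1' : ∀ m, ∑ g, c g * c (m + g) = n * c m)
    (h2 : ∀ m, ∑ g ∈ Finset.univ.filter (fun g => 0 < c g), c (m - g) = 2 * c m)
    (h3 : ∀ g, c g ≠ 0) (h4 : 0 < c 0) (h5 : ∀ g, g ≠ 0 → c g < c 0) (h6 : ∃ g, g ≠ 0 ∧ 0 < c g)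
    (h7 : ∑ g, c g = 0) : WanderUnit r := by
  have shift : ∀ (f : H → ℝ) (a : H → ℤ) (A : Finset H) (b : H → ℤ) (h : H),
      ∑ g ∈ A, (a g : ℝ) * ∑ k, (b k : ℝ) * f (h + g + k) =
        ∑ m, ((∑ g ∈ A, a g * b (m - g) : ℤ) : ℝ) * f (h + m) := by
    intro f a A b h
    have : ∀ g, ∑ k, (b k : ℝ) * f (h + g + k) = ∑ m, (b (m - g) : ℝ) * f (h + m) := by
      intro g
      refine Fintype.sum_equiv (Equiv.addLeft g) _ _ fun k => ?_
      simp [add_assoc]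
    simp_rw [this, Finset.mul_sum]
    rw [Finset.sum_comm]
    refine Finset.sum_congr rfl fun m _ => ?_
    push_cast
    rw [Finset.sum_mul]
    exact Finset.sum_congr rfl fun g _ => by ring
  have hn' : (0 : ℝ) < n := by exact_mod_cast hn
  let Q : (H → ℝ) → Prop := fun f => (∀ h, ∑ g, (c g : ℝ) * f (h + g) = n * f h) ∧
    ∃ K : ℝ, 0 < K ∧ ∀ h, |f h - K * c h| < K / 2
  have hQ : ∀ f, Q f → 0 < f 0 ∧ (∀ h ≠ 0, f h ≠ f 0) ∧ (∃ h ≠ 0, 0 < f h) ∧ Q (Tmap f) := by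
    rintro f ⟨hf, K, hK, hfK⟩
    have hA : ∀ g, 0 < f g ↔ 0 < c g := by
      intro g
      have h := abs_lt.1 (hfK g)
      constructor
      · intro hfg
        by_contra hcon
        have : c g ≤ -1 := by have := h3 g; omega
        have : (c g : ℝ) ≤ -1 := by exact_mod_cast this
        nlinarith [h.1, h.2]
      · intro hcg
        have : (1 : ℝ) ≤ c g := by exact_mod_cast hcg
        nlinarith [h.1, h.2]
    have hT : ∀ h, Tmap f h = 2 * f h := by
      intro h
      rw [tmap_filter f (Finset.univ.filter (fun g => 0 < c g)) (by simpa using hA)]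
      have key := shift f (fun _ => 1) (Finset.univ.filter (fun g => 0 < c g)) c h
      simp only [hf, one_mul, Int.cast_one, h2] at key
      have h8 : ∑ m, ((2 * c m : ℤ) : ℝ) * f (h + m) = 2 * (n * f h) := by
        rw [← hf, Finset.mul_sum]
        exact Finset.sum_congr rfl fun m _ => by push_cast; ring
      rw [h8, ← Finset.mul_sum] at key
      have : (n : ℝ) * (∑ g ∈ Finset.univ.filter (fun g => 0 < c g), f (h + g)) = n * (2 * f h) := by
        linarith
      exact mul_left_cancel₀ hn'.ne' this
    refine ⟨(hA 0).2 h4, ?_, ?_, ?_⟩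
    · intro h hh heq
      have ha := abs_lt.1 (hfK h)
      have hb := abs_lt.1 (hfK 0)
      have : (c h : ℝ) + 1 ≤ c 0 := by exact_mod_cast h5 h hh
      nlinarith [ha.1, ha.2, hb.1, hb.2]
    · obtain ⟨g, hg, hg'⟩ := h6
      exact ⟨g, hg, (hA g).2 hg'⟩
    · refine ⟨fun h => ?_, 2 * K, by linarith, fun h => ?_⟩
      · simp only [hT]
        rw [mul_left_comm, ← hf, Finset.mul_sum]
        exact Finset.sum_congr rfl fun m _ => by ring
      · rw [hT, mul_assoc, ← mul_sub, abs_mul, abs_two]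
        linarith [hfK h]
  obtain ⟨C, hC⟩ := dense_units r e (fun h => (c h : ℝ)) (by exact_mod_cast h7)
  have hC0 : 0 ≤ C := by
    obtain ⟨u, hu⟩ := hC 0
    exact (abs_nonneg _).trans (hu 0)
  set B : ℝ := ∑ g, |(c g : ℝ)| with hB
  have hB0 : 0 ≤ B := Finset.sum_nonneg fun _ _ => abs_nonneg _
  obtain ⟨w, hw⟩ := hC (2 * (B * C) + 1)
  set N := 2 * (B * C) + 1 with hN
  have hBC : 0 ≤ B * C := mul_nonneg hB0 hC0
  obtain ⟨x, hx0, hx1, hx2, hx⟩ := conv_unit r e c w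
  refine ⟨x, hx0, hx1, hx2, wander r e Q hQ x hx1 hx0 ⟨?_, N * n, by positivity, ?_⟩⟩
  · intro h
    simp only [hx]
    rw [shift _ c Finset.univ c h]
    simp only [h1]
    rw [Finset.mul_sum]
    exact Finset.sum_congr rfl fun m _ => by push_cast; ring
  · intro h
    have : lvec r e x h - N * n * c h =
        ∑ g, (c g : ℝ) * (lvec r e (w : L) (h + g) - N * c (h + g)) := by
      rw [hx]
      have h8 : (n : ℝ) * c h = ∑ g, (c g : ℝ) * c (h + g) := by exact_mod_cast (h1' h).symm
      rw [mul_assoc, h8, Finset.mul_sum, ← Finset.sum_sub_distrib]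
      exact Finset.sum_congr rfl fun g _ => by ring
    rw [this]
    have h9 : |∑ g, (c g : ℝ) * (lvec r e (w : L) (h + g) - N * c (h + g))| ≤ B * C := by
      refine (Finset.abs_sum_le_sum_abs _ _).trans ?_
      rw [hB, Finset.sum_mul]
      refine Finset.sum_le_sum fun g _ => ?_
      rw [abs_mul]
      exact mul_le_mul_of_nonneg_left (hw _) (abs_nonneg _)
    have hn1 : (1 : ℝ) ≤ n := by exact_mod_cast hn
    have : N ≤ N * n := le_mul_of_one_le_right (by positivity) hn1
    linarith

lemma wander_C6 (r : L →+* ℝ) (e : Multiplicative (ZMod 2 × ZMod 3) ≃* (L ≃ₐ[ℚ] L)) :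
    WanderUnit r :=
  wander_integral r e
    (fun g => (if g.1 = 0 then 1 else -1) * (if g.2 = 0 then 2 else -1)) 6 (by norm_num)
    (by decide) (by decide) (by decide) (by decide) (by decide) (by decide) (by decide) (by decide)

lemma wander_C222 (r : L →+* ℝ)
    (e : Multiplicative (ZMod 2 × ZMod 2 × ZMod 2) ≃* (L ≃ₐ[ℚ] L)) :
    WanderUnit r :=
  wander_integral r e
    (fun g => (if g.1 = 0 then 1 else -1) + (if g.2.1 = 0 then 1 else -1) +
      (if g.2.2 = 0 then 1 else -1)) 8 (by norm_num)
    (by decide) (by decide) (by decide) (by decide) (by decide) (by decide) (by decide) (by decide)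

lemma wander_C33 (r : L →+* ℝ)
    (e : Multiplicative (ZMod 3 × ZMod 3) ≃* (L ≃ₐ[ℚ] L)) :
    WanderUnit r :=
  wander_integral r e
    (fun g => (if g.1 = 0 then 2 else -1) + (if g.2 = 0 then 2 else -1)) 9 (by norm_num)
    (by decide) (by decide) (by decide) (by decide) (by decide) (by decide) (by decide) (by decide)

lemma wander_C4 (r : L →+* ℝ) (e : Multiplicative (ZMod 4) ≃* (L ≃ₐ[ℚ] L)) :
    WanderUnit r := by
  let Q : (ZMod 4 → ℝ) → Prop := fun f => f 2 = - f 0 ∧ f 3 = - f 1 ∧ |f 1| < f 0 ∧ f 1 ≠ 0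
  have hQ : ∀ f, Q f → 0 < f 0 ∧ (∀ h ≠ 0, f h ≠ f 0) ∧ (∃ h ≠ 0, 0 < f h) ∧ Q (Tmap f) := by
    rintro f ⟨h2, h3, h1, h0⟩
    have hpos : 0 < f 0 := (abs_nonneg _).trans_lt h1
    have habs := abs_lt.1 h1
    have h4 : ∀ h : ZMod 4, h = 0 ∨ h = 1 ∨ h = 2 ∨ h = 3 := by decide
    refine ⟨hpos, ?_, ?_, ?_⟩
    · intro h hh
      rcases h4 h with rfl | rfl | rfl | rfl
      · exact absurd rfl hh
      · exact ne_of_lt habs.2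
      · rw [h2]; intro; linarith
      · rw [h3]; intro; linarith
    · rcases lt_or_gt_of_ne h0 with h | h
      · exact ⟨3, by decide, by linarith⟩
      · exact ⟨1, by decide, h⟩
    · have e1 : (1 : ZMod 4) + 1 = 2 := by decide
      have e2 : (2 : ZMod 4) + 1 = 3 := by decide
      have e3 : (3 : ZMod 4) + 1 = 0 := by decide
      have e4 : (1 : ZMod 4) + 3 = 0 := by decide
      have e5 : (2 : ZMod 4) + 3 = 1 := by decide
      have e6 : (3 : ZMod 4) + 3 = 2 := by decide
      rcases lt_or_gt_of_ne h0 with h | h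
      · have hA : ∀ h, Tmap f h = f (h + 0) + f (h + 3) := by
          intro k
          rw [tmap_filter f {0, 3}, Finset.sum_pair (by decide)]
          intro g
          rcases h4 g with rfl | rfl | rfl | rfl
          · simp [hpos]
          · simp only [(by decide : (1 : ZMod 4) ∈ ({0, 3} : Finset (ZMod 4)) ↔ False), iff_false]
            linarith
          · simp only [(by decide : (2 : ZMod 4) ∈ ({0, 3} : Finset (ZMod 4)) ↔ False), iff_false]
            linarith
          · simp only [(by decide : (3 : ZMod 4) ∈ ({0, 3} : Finset (ZMod 4)) ↔ True), iff_true]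
            linarith
        simp only [Q, hA, add_zero, zero_add, e4, e5, e6, h2, h3]
        refine ⟨by ring, by ring, abs_lt.2 ⟨by linarith, by linarith⟩, ?_⟩
        exact ne_of_gt (by linarith [habs.1])
      · have hA : ∀ h, Tmap f h = f (h + 0) + f (h + 1) := by
          intro k
          rw [tmap_filter f {0, 1}, Finset.sum_pair (by decide)]
          intro g
          rcases h4 g with rfl | rfl | rfl | rfl
          · simp [hpos]
          · simp [h]
          · simp only [(by decide : (2 : ZMod 4) ∈ ({0, 1} : Finset (ZMod 4)) ↔ False), iff_false]
            linarith
          · simp only [(by decide : (3 : ZMod 4) ∈ ({0, 1} : Finset (ZMod 4)) ↔ False), iff_false]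
            linarith
        simp only [Q, hA, add_zero, zero_add, e1, e2, e3, h2, h3]
        refine ⟨by ring, by ring, abs_lt.2 ⟨by linarith, by linarith⟩, ?_⟩
        exact ne_of_lt (by linarith [habs.2])
  have hsum : ∀ F : ZMod 4 → ℝ, ∑ g, F g = F 0 + F 1 + F 2 + F 3 := fun F => Fin.sum_univ_four F
  let v : ZMod 4 → ℝ := ![2, 1, -2, -1]
  have v0 : v 0 = 2 := rfl
  have v1 : v 1 = 1 := rfl
  have v2 : v 2 = -2 := rfl
  have v3 : v 3 = -1 := rfl
  obtain ⟨C, hC⟩ := dense_units r e v (by rw [hsum, v0, v1, v2, v3]; norm_num)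
  have hC0 : 0 ≤ C := by
    obtain ⟨u, hu⟩ := hC 0
    exact (abs_nonneg _).trans (hu 0)
  obtain ⟨w, hw⟩ := hC (4 * C + 1)
  let c : ZMod 4 → ℤ := ![1, 0, -1, 0]
  have c0 : c 0 = 1 := rfl
  have c1 : c 1 = 0 := rfl
  have c2 : c 2 = -1 := rfl
  have c3 : c 3 = 0 := rfl
  obtain ⟨x, hx0, hx1, hx2, hx⟩ := conv_unit r e c w
  simp only [hsum, c0, c1, c2, c3] at hx
  have x0 := hx 0
  have x1 := hx 1
  have x2 := hx 2
  have x3 := hx 3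
  rw [show (1 : ZMod 4) + 2 = 3 by decide] at x1
  rw [show (2 : ZMod 4) + 2 = 0 by decide] at x2
  rw [show (3 : ZMod 4) + 2 = 1 by decide] at x3
  simp only [add_zero, zero_add] at x0 x1 x2 x3
  push_cast at x0 x1 x2 x3
  have w0 := abs_le.1 (hw 0)
  have w1 := abs_le.1 (hw 1)
  have w2 := abs_le.1 (hw 2)
  have w3 := abs_le.1 (hw 3)
  rw [v0] at w0
  rw [v1] at w1
  rw [v2] at w2
  rw [v3] at w3
  refine ⟨x, hx0, hx1, hx2, wander r e Q hQ x hx1 hx0 ⟨?_, ?_, ?_, ?_⟩⟩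
  · linarith
  · linarith
  · rw [abs_lt]; constructor <;> linarith
  · have : 0 < lvec r e x 1 := by linarith
    exact this.ne'

end Cases

set_option linter.unusedSectionVars false

section OddCyclic
open ZMod

variable {n : ℕ} [NeZero n]

/-- The vector of cosines. -/
noncomputable def vcos (g : ZMod n) : ℝ := (stdAddChar g : ℂ).re

open Classical in
/-- The positive part of the vector of cosines. -/
noncomputable def posA (n : ℕ) [NeZero n] : Finset (ZMod n) :=
  Finset.univ.filter fun g => 0 < vcos g

lemma std_int (j : ℤ) :
    (stdAddChar (j : ZMod n) : ℂ) = Complex.exp (Complex.I * ((2 * Real.pi * j / n : ℝ) : ℂ)) := by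
  rw [stdAddChar_coe]
  congr 1
  push_cast
  ring

lemma vcos_int (j : ℤ) : vcos (j : ZMod n) = Real.cos (2 * Real.pi * j / n) := by
  rw [vcos, std_int, mul_comm, Complex.exp_ofReal_mul_I_re]

lemma std_norm (g : ZMod n) : ‖(stdAddChar g : ℂ)‖ = 1 := by
  rw [stdAddChar_apply]; exact Circle.norm_coe _

lemma std_sub_one (j : ℤ) :
    ‖(stdAddChar (j : ZMod n) : ℂ) - 1‖ = 2 * |Real.sin (Real.pi * j / n)| := by
  rw [std_int, Complex.norm_exp_I_mul_ofReal_sub_one, norm_mul, Real.norm_eq_abs, Real.norm_eq_abs,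
    abs_two]
  congr 3
  ring

lemma vcos_neg (g : ZMod n) : vcos (-g) = vcos g := by
  obtain ⟨j, rfl⟩ := ZMod.intCast_surjective g
  rw [← Int.cast_neg, vcos_int, vcos_int]
  rw [← Real.cos_neg]
  congr 1
  push_cast
  ring

lemma vcos_zero : vcos (0 : ZMod n) = 1 := by simp [vcos]

lemma vcos_lt (g : ZMod n) (hg : g ≠ 0) : vcos g < 1 := by
  have h1 : ‖(stdAddChar g : ℂ)‖ = 1 := std_norm g
  refine lt_of_le_of_ne ((Complex.re_le_norm _).trans h1.le) fun h => hg ?_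
  apply injective_stdAddChar
  rw [AddChar.map_zero_eq_one]
  have h2 : (stdAddChar g : ℂ).im = 0 := by
    have := Complex.sq_norm (stdAddChar g : ℂ)
    rw [h1, Complex.normSq_apply] at this
    have h3 : (stdAddChar g : ℂ).re = 1 := h
    rw [h3] at this
    nlinarith
  exact Complex.ext h (by simpa using h2)

lemma vcos_ne (hn : Odd n) (g : ZMod n) : vcos g ≠ 0 := by
  obtain ⟨j, rfl⟩ := ZMod.intCast_surjective g
  rw [vcos_int, Real.cos_ne_zero_iff]
  intro k hk
  have hn0 : (n : ℝ) ≠ 0 := by exact_mod_cast NeZero.ne n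
  have hpi := Real.pi_pos
  rw [div_eq_iff hn0] at hk
  have h1 : Real.pi * (4 * j) = Real.pi * ((2 * k + 1) * n) := by linarith
  have h2 := mul_left_cancel₀ hpi.ne' h1
  have h3 : 4 * j = (2 * k + 1) * (n : ℤ) := by exact_mod_cast h2
  obtain ⟨l, rfl⟩ := hn
  have h4 : (2 * k + 1) * ((2 * l + 1 : ℕ) : ℤ) = 2 * (2 * k * l + k + l) + 1 := by push_cast; ring
  omega

lemma vcos_pos_of (hn : Odd n) (j : ℤ) (hj : 4 * |j| ≤ n) : 0 < vcos (j : ZMod n) := by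
  have hn0 : (0 : ℝ) < n := by exact_mod_cast NeZero.pos n
  refine lt_of_le_of_ne ?_ (vcos_ne hn _).symm
  rw [vcos_int, ← Real.cos_abs]
  have hj' : 4 * |(j : ℝ)| ≤ n := by exact_mod_cast hj
  have hpi := Real.pi_pos
  apply Real.cos_nonneg_of_neg_pi_div_two_le_of_le
  · have := abs_nonneg (2 * Real.pi * j / n); linarith
  · rw [abs_div, abs_mul, abs_of_pos (by positivity : 0 < 2 * Real.pi), abs_of_pos hn0,
      div_le_iff₀ hn0]
    nlinarith

lemma vcos_neg_of (j : ℤ) (h1 : (n : ℤ) ≤ 4 * |j|) (h2 : 2 * |j| ≤ n) :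
    vcos (j : ZMod n) ≤ 0 := by
  have hn0 : (0 : ℝ) < n := by exact_mod_cast NeZero.pos n
  rw [vcos_int, ← Real.cos_abs]
  have h1' : (n : ℝ) ≤ 4 * |(j : ℝ)| := by exact_mod_cast h1
  have h2' : 2 * |(j : ℝ)| ≤ n := by exact_mod_cast h2
  have hpi := Real.pi_pos
  apply Real.cos_nonpos_of_pi_div_two_le_of_le
  · rw [abs_div, abs_mul, abs_of_pos (by positivity : 0 < 2 * Real.pi), abs_of_pos hn0,
      le_div_iff₀ hn0]
    nlinarith
  · rw [abs_div, abs_mul, abs_of_pos (by positivity : 0 < 2 * Real.pi), abs_of_pos hn0,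
      div_le_iff₀ hn0]
    nlinarith

lemma sum_posA (hn : Odd n) {M : Type*} [AddCommMonoid M] (F : ZMod n → M) :
    ∑ g ∈ posA n, F g =
      ∑ j ∈ Finset.range (2 * (n / 4) + 1), F (((j : ℤ) - ((n / 4 : ℕ) : ℤ) : ℤ) : ZMod n) := by
  symm
  have hn0 := NeZero.pos n
  refine Finset.sum_nbij (fun j => (((j : ℤ) - ((n / 4 : ℕ) : ℤ) : ℤ) : ZMod n)) ?_ ?_ ?_ ?_
  · intro j hj
    rw [Finset.mem_range] at hj
    simp only [posA, Finset.mem_filter, Finset.mem_univ, true_and]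
    apply vcos_pos_of hn
    have : |(j : ℤ) - ((n / 4 : ℕ) : ℤ)| ≤ ((n / 4 : ℕ) : ℤ) := by
      rw [abs_le]; constructor <;> omega
    omega
  · intro i hi j hj hij
    simp only [Finset.coe_range, Set.mem_Iio] at hi hj
    rw [ZMod.intCast_eq_intCast_iff_dvd_sub] at hij
    have := Int.eq_zero_of_abs_lt_dvd hij (by rw [abs_lt]; constructor <;> omega)
    omega
  · intro g hg
    simp only [posA, Finset.coe_filter, Finset.mem_univ, true_and, Set.mem_ofPred_eq] at hg
    have h1 : |g.valMinAbs| < ((n / 4 : ℕ) : ℤ) + 1 := by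
      by_contra hcon
      have h3 := natAbs_valMinAbs_le g
      have h4 := Int.abs_eq_natAbs g.valMinAbs
      have h2 := vcos_neg_of (n := n) g.valMinAbs (by omega) (by omega)
      rw [coe_valMinAbs] at h2
      linarith
    rw [abs_lt] at h1
    refine ⟨(g.valMinAbs + ((n / 4 : ℕ) : ℤ)).toNat, ?_, ?_⟩
    · simp only [Finset.coe_range, Set.mem_Iio]; omega
    · have : (((g.valMinAbs + ((n / 4 : ℕ) : ℤ)).toNat : ℤ) - ((n / 4 : ℕ) : ℤ)) = g.valMinAbs := by
        omega
      simp only [this, coe_valMinAbs]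
  · intro j _; rfl

/-- Eigenvalues. -/
noncomputable def Seig (k : ZMod n) : ℂ := ∑ g ∈ posA n, (stdAddChar (g * k) : ℂ)

/-- The main eigenvalue. -/
noncomputable def lamA (n : ℕ) [NeZero n] : ℝ := ∑ g ∈ posA n, vcos g

lemma neg_posA {M : Type*} [AddCommMonoid M] (F : ZMod n → M) :
    ∑ g ∈ posA n, F (-g) = ∑ g ∈ posA n, F g := by
  refine Finset.sum_nbij' (fun g => -g) (fun g => -g) ?_ ?_ ?_ ?_ ?_ <;>
    simp [posA, vcos_neg]

lemma std_conj (g : ZMod n) : (stdAddChar (-g) : ℂ) = (starRingEnd ℂ) (stdAddChar g) := by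
  rw [AddChar.map_neg_eq_inv, ← Complex.inv_eq_conj (std_norm g)]

lemma Seig_one : Seig (1 : ZMod n) = (lamA n : ℂ) := by
  have h1 : Seig (1 : ZMod n) = ∑ g ∈ posA n, (stdAddChar g : ℂ) := by simp [Seig]
  have h2 : (starRingEnd ℂ) (∑ g ∈ posA n, (stdAddChar g : ℂ)) =
      ∑ g ∈ posA n, (stdAddChar g : ℂ) := by
    rw [map_sum]
    simp_rw [← std_conj]
    exact neg_posA fun g => (stdAddChar g : ℂ)
  rw [h1]
  rw [Complex.conj_eq_iff_re] at h2
  rw [← h2, Complex.re_sum]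
  rfl

lemma Seig_neg_one : Seig (-1 : ZMod n) = (lamA n : ℂ) := by
  rw [← Seig_one, Seig, Seig, ← neg_posA]
  simp

lemma lamA_pos : 0 < lamA n := by
  refine Finset.sum_pos (fun g hg => ?_) ⟨0, ?_⟩
  · simpa [posA] using hg
  · simp [posA, vcos_zero]

lemma Seig_mul (hn : Odd n) (k : ZMod n) :
    ‖Seig k‖ * ‖(stdAddChar k : ℂ) - 1‖ =
      ‖(stdAddChar (((2 * (n / 4) + 1 : ℕ) : ZMod n) * k) : ℂ) - 1‖ := by
  have h1 : Seig k = (stdAddChar (-((n / 4 : ℕ) : ZMod n) * k) : ℂ) *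
      ∑ j ∈ Finset.range (2 * (n / 4) + 1), (stdAddChar k : ℂ) ^ j := by
    rw [Seig, sum_posA hn, Finset.mul_sum]
    refine Finset.sum_congr rfl fun j _ => ?_
    rw [← AddChar.map_nsmul_eq_pow, ← AddChar.map_add_eq_mul]
    congr 1
    simp only [Int.cast_sub, Int.cast_natCast, nsmul_eq_mul]
    ring
  rw [h1, norm_mul, std_norm, one_mul, ← norm_mul, geom_sum_mul, ← AddChar.map_nsmul_eq_pow,
    nsmul_eq_mul]

lemma sin_mid {x : ℝ} (h1 : Real.pi / 4 ≤ x) (h2 : x ≤ 3 * Real.pi / 4) :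
    √2 / 2 ≤ Real.sin x := by
  have hpi := Real.pi_pos
  rw [← Real.cos_pi_div_two_sub, ← Real.cos_pi_div_four, ← Real.cos_abs (Real.pi / 2 - x)]
  apply Real.cos_le_cos_of_nonneg_of_le_pi (abs_nonneg _) (by linarith)
  rw [abs_le]; constructor <;> linarith

lemma lamA_bound (hn : Odd n) (hn5 : 5 ≤ n) : √2 ≤ lamA n * (2 * Real.sin (Real.pi / n)) := by
  have h := Seig_mul hn (1 : ZMod n)
  have hn0 : (0 : ℝ) < n := by exact_mod_cast NeZero.pos n
  have hpi := Real.pi_pos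
  have e1 : (1 : ZMod n) = ((1 : ℤ) : ZMod n) := by simp
  rw [Seig_one, mul_one, ← Int.cast_natCast (2 * (n / 4) + 1), e1, std_sub_one, std_sub_one,
    Complex.norm_real, Real.norm_eq_abs, abs_of_pos lamA_pos] at h
  have hn5' : (5 : ℝ) ≤ n := by exact_mod_cast hn5
  have hs : 0 ≤ Real.sin (Real.pi / n) := by
    apply Real.sin_nonneg_of_nonneg_of_le_pi (by positivity)
    rw [div_le_iff₀ hn0]; nlinarith
  rw [Int.cast_one, mul_one, abs_of_nonneg hs] at h
  rw [h]
  have ha : n ≤ 4 * (2 * (n / 4) + 1) := by omega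
  have hb : 4 * (2 * (n / 4) + 1) ≤ 3 * n := by omega
  have ha' : (n : ℝ) ≤ 4 * ((2 * (n / 4) + 1 : ℕ) : ℝ) := by exact_mod_cast ha
  have hb' : 4 * ((2 * (n / 4) + 1 : ℕ) : ℝ) ≤ 3 * n := by exact_mod_cast hb
  have := sin_mid (x := Real.pi * (((2 * (n / 4) + 1 : ℕ) : ℤ) : ℝ) / n)
    (by rw [le_div_iff₀ hn0, Int.cast_natCast]; nlinarith)
    (by rw [div_le_iff₀ hn0, Int.cast_natCast]; nlinarith)
  have h5 := le_abs_self (Real.sin (Real.pi * (((2 * (n / 4) + 1 : ℕ) : ℤ) : ℝ) / n))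
  linarith

lemma Seig_le (hn : Odd n) (hn5 : 5 ≤ n) (k : ZMod n) (hk : k ≠ 0) : ‖Seig k‖ ≤ lamA n := by
  have hpi := Real.pi_pos
  have hn0 : (0 : ℝ) < n := by exact_mod_cast NeZero.pos n
  have hn5' : (5 : ℝ) ≤ n := by exact_mod_cast hn5
  by_cases hk1 : k = 1
  · rw [hk1, Seig_one, Complex.norm_real, Real.norm_eq_abs, abs_of_pos lamA_pos]
  by_cases hk2 : k = -1
  · rw [hk2, Seig_neg_one, Complex.norm_real, Real.norm_eq_abs, abs_of_pos lamA_pos]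
  have h := Seig_mul hn k
  have h2 : ‖Seig k‖ * ‖(stdAddChar k : ℂ) - 1‖ ≤ 2 := by
    rw [h]
    refine (norm_sub_le _ _).trans ?_
    rw [std_norm, norm_one]; norm_num
  have hj := coe_valMinAbs k
  set j := k.valMinAbs with hjdef
  have hjle := natAbs_valMinAbs_le k
  rw [← hjdef] at hjle
  have hj2 : 2 ≤ |j| := by
    by_contra hcon
    have : j = 0 ∨ j = 1 ∨ j = -1 := by
      have h3 := abs_lt.1 (not_le.1 hcon)
      omega
    rcases this with h | h | h
    · exact hk (by rw [← hj, h]; simp)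
    · exact hk1 (by rw [← hj, h]; simp)
    · exact hk2 (by rw [← hj, h]; simp)
  have hj2' : (2 : ℝ) ≤ |(j : ℝ)| := by exact_mod_cast hj2
  have hj3 : 2 * |j| ≤ n := by
    have h4 := Int.abs_eq_natAbs j
    omega
  have hj3' : 2 * |(j : ℝ)| ≤ n := by exact_mod_cast hj3
  have hs : |Real.sin (Real.pi * j / n)| = Real.sin (Real.pi * |(j : ℝ)| / n) := by
    rcases abs_cases (j : ℝ) with ⟨h, h'⟩ | ⟨h, h'⟩
    · rw [h] at hj3' ⊢
      refine abs_of_nonneg (Real.sin_nonneg_of_nonneg_of_le_pi (by positivity) ?_)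
      rw [div_le_iff₀ hn0]; nlinarith
    · rw [h] at hj3' ⊢
      rw [mul_neg, neg_div, Real.sin_neg]
      refine abs_of_nonpos ?_
      rw [← neg_nonneg, ← Real.sin_neg]
      refine (Real.sin_nonneg_of_nonneg_of_le_pi ?_ ?_)
      · rw [← neg_div, ← mul_neg]
        have : 0 < -(j : ℝ) := by linarith
        positivity
      · rw [← neg_div, ← mul_neg, div_le_iff₀ hn0]; nlinarith
  have hs2 : Real.sin (2 * (Real.pi / n)) ≤ Real.sin (Real.pi * |(j : ℝ)| / n) := by
    apply Real.sin_le_sin_of_le_of_le_pi_div_two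
    · have : 0 < 2 * (Real.pi / n) := by positivity
      linarith
    · rw [div_le_iff₀ hn0]; nlinarith
    · rw [← mul_div_assoc, div_le_div_iff_of_pos_right hn0]
      nlinarith
  rw [Real.sin_two_mul] at hs2
  have hcos : √2 / 2 ≤ Real.cos (Real.pi / n) := by
    rw [← Real.cos_pi_div_four]
    apply Real.cos_le_cos_of_nonneg_of_le_pi (by positivity) (by linarith)
    apply div_le_div_of_nonneg_left hpi.le (by norm_num) (by linarith)
  have hsp : 0 < Real.sin (Real.pi / n) := by
    apply Real.sin_pos_of_pos_of_lt_pi (by positivity)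
    rw [div_lt_iff₀ hn0]; nlinarith
  rw [← hj, std_sub_one, hs, hj] at h2
  have hlam := lamA_bound hn hn5
  have h22 : √2 * √2 = 2 := Real.mul_self_sqrt (by norm_num)
  have hs22 : (0 : ℝ) < √2 := by positivity
  set s := Real.sin (Real.pi / n)
  set S := Real.sin (Real.pi * |(j : ℝ)| / n)
  have hS : √2 * s ≤ S := by nlinarith
  have hSp : 0 < S := lt_of_lt_of_le (by positivity) hS
  have h6 : 2 ≤ lamA n * (2 * S) := by
    have h7 : √2 * √2 ≤ √2 * (lamA n * (2 * s)) := mul_le_mul_of_nonneg_left hlam hs22.le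
    have h8 : lamA n * (√2 * s) ≤ lamA n * S := mul_le_mul_of_nonneg_left hS lamA_pos.le
    nlinarith
  exact le_of_mul_le_mul_right (h2.trans h6) (by positivity)


/-- The (sum of absolute values of) Fourier coefficients. -/
noncomputable def fnorm (f : ZMod n → ℝ) : ℝ := ∑ k, ‖ZMod.dft (fun h => (f h : ℂ)) k‖

lemma le_fnorm (f : ZMod n → ℝ) (h : ZMod n) : |f h| ≤ fnorm f := by
  have hn1 : (1 : ℝ) ≤ n := by exact_mod_cast NeZero.one_le
  have h1 : (f h : ℂ) = ZMod.dft.symm (ZMod.dft (fun h => (f h : ℂ))) h := by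
    rw [LinearEquiv.symm_apply_apply]
  rw [← Real.norm_eq_abs, ← Complex.norm_real, h1, invDFT_apply, smul_eq_mul, norm_mul, norm_inv,
    Complex.norm_natCast]
  have h2 : ‖∑ j : ZMod n, (stdAddChar (j * h) : ℂ) • (ZMod.dft (fun h => (f h : ℂ))) j‖ ≤
      fnorm f := by
    refine (norm_sum_le _ _).trans (Finset.sum_le_sum fun j _ => ?_)
    rw [smul_eq_mul, norm_mul, std_norm, one_mul]
  refine le_trans ?_ h2
  exact mul_le_of_le_one_left (norm_nonneg _) (inv_le_one_of_one_le₀ hn1)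

lemma fnorm_le (f : ZMod n → ℝ) (C : ℝ) (hC : ∀ h, |f h| ≤ C) : fnorm f ≤ n * (n * C) := by
  unfold fnorm
  have : ∀ k ∈ (Finset.univ : Finset (ZMod n)), ‖ZMod.dft (fun h => (f h : ℂ)) k‖ ≤ n * C := by
    intro k _
    rw [dft_apply]
    refine (norm_sum_le _ _).trans ?_
    refine (Finset.sum_le_card_nsmul _ _ C fun j _ => ?_).trans ?_
    · rw [smul_eq_mul, norm_mul, std_norm, one_mul, Complex.norm_real]
      exact hC j
    · simp [ZMod.card]
  refine (Finset.sum_le_card_nsmul _ _ _ this).trans ?_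
  simp [ZMod.card]

/-- Convolution with the positive part. -/
noncomputable def TA (f : ZMod n → ℝ) (h : ZMod n) : ℝ := ∑ g ∈ posA n, f (h + g)

lemma dft_TA (f : ZMod n → ℝ) (k : ZMod n) :
    ZMod.dft (fun h => (TA f h : ℂ)) k = Seig k * ZMod.dft (fun h => (f h : ℂ)) k := by
  rw [dft_apply, dft_apply, Seig, Finset.sum_mul]
  simp only [TA, Complex.ofReal_sum, Finset.smul_sum]
  rw [Finset.sum_comm]
  refine Finset.sum_congr rfl fun g _ => ?_
  rw [Finset.mul_sum]
  refine Fintype.sum_equiv (Equiv.addRight g) _ _ fun j => ?_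
  simp only [Equiv.coe_addRight, smul_eq_mul]
  rw [← mul_assoc, ← AddChar.map_add_eq_mul]
  congr 2
  ring

lemma fnorm_TA (hn : Odd n) (hn5 : 5 ≤ n) (f : ZMod n → ℝ) (hf : ∑ h, f h = 0) :
    fnorm (TA f) ≤ lamA n * fnorm f := by
  unfold fnorm
  rw [Finset.mul_sum]
  refine Finset.sum_le_sum fun k _ => ?_
  rw [dft_TA, norm_mul]
  by_cases hk : k = 0
  · have : ZMod.dft (fun h => (f h : ℂ)) k = 0 := by
      rw [hk, dft_apply_zero]; exact_mod_cast hf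
    rw [this]; simp
  · exact mul_le_mul_of_nonneg_right (Seig_le hn hn5 k hk) (norm_nonneg _)

lemma TA_vcos (h : ZMod n) : TA vcos h = lamA n * vcos h := by
  have h1 : ∑ g ∈ posA n, (stdAddChar (h + g) : ℂ) = (lamA n : ℂ) * stdAddChar h := by
    rw [← Seig_one, Seig, Finset.sum_mul]
    refine Finset.sum_congr rfl fun g _ => ?_
    rw [← AddChar.map_add_eq_mul]
    congr 1
    ring
  have h2 := congrArg Complex.re h1
  rw [Complex.re_sum, Complex.re_ofReal_mul] at h2
  exact h2

lemma sum_vcos (hn5 : 5 ≤ n) : ∑ g : ZMod n, vcos g = 0 := by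
  have h1 : ∑ g : ZMod n, (stdAddChar g : ℂ) = 0 := by
    apply AddChar.sum_eq_zero_of_ne_one
    intro h
    have h2 : (stdAddChar (1 : ZMod n) : ℂ) = stdAddChar (0 : ZMod n) := by
      rw [h]; simp
    have h3 : (1 : ZMod n) = 0 := injective_stdAddChar h2
    have : Fact (1 < n) := ⟨by omega⟩
    exact one_ne_zero h3
  have h2 := congrArg Complex.re h1
  rw [Complex.re_sum] at h2
  exact h2

lemma sum_TA (f : ZMod n → ℝ) (hf : ∑ h, f h = 0) : ∑ h, TA f h = 0 := by
  unfold TA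
  rw [Finset.sum_comm]
  refine Finset.sum_eq_zero fun g _ => ?_
  rw [← hf]
  exact Fintype.sum_equiv (Equiv.addRight g) _ _ fun j => rfl

lemma exists_delta {ι : Type*} [Finite ι] (p : ι → ℝ) (hp : ∀ i, 0 < p i) :
    ∃ δ > 0, ∀ i, δ ≤ p i := by
  rcases isEmpty_or_nonempty ι with h | h
  · exact ⟨1, one_pos, fun i => (h.false i).elim⟩
  · obtain ⟨i, hi⟩ := Finite.exists_min p
    exact ⟨p i, hp i, hi⟩

lemma wander_odd {L : Type*} [Field L] [NumberField L] [IsGalois ℚ L] (hn : Odd n) (hn5 : 5 ≤ n)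
    (r : L →+* ℝ) (e : Multiplicative (ZMod n) ≃* (L ≃ₐ[ℚ] L)) : WanderUnit r := by
  obtain ⟨d1, hd1, hd1'⟩ := exists_delta (fun g : ZMod n => |vcos g|)
    fun g => abs_pos.2 (vcos_ne hn g)
  obtain ⟨d2, hd2, hd2'⟩ := exists_delta (fun g : {g : ZMod n // g ≠ 0} => 1 - vcos g.1)
    fun g => by linarith [vcos_lt g.1 g.2]
  set δ := min d1 (d2 / 2) with hδ
  have hδ0 : 0 < δ := lt_min hd1 (by linarith)
  have hδ1 : ∀ g : ZMod n, δ ≤ |vcos g| := fun g => (min_le_left _ _).trans (hd1' g)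
  have hδ2 : ∀ g : ZMod n, g ≠ 0 → 2 * δ ≤ 1 - vcos g := fun g hg => by
    have := hd2' ⟨g, hg⟩
    have := min_le_right d1 (d2 / 2)
    simp only at *
    linarith
  let Q : (ZMod n → ℝ) → Prop := fun f => ∑ h, f h = 0 ∧
    ∃ c > 0, fnorm (fun h => f h - c * vcos h) < c * δ
  have hQ : ∀ f, Q f → 0 < f 0 ∧ (∀ h ≠ 0, f h ≠ f 0) ∧ (∃ h ≠ 0, 0 < f h) ∧ Q (Tmap f) := by
    rintro f ⟨hf, c, hc, hfc⟩
    have hsup : ∀ h, |f h - c * vcos h| < c * δ := fun h =>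
      (le_fnorm (fun h => f h - c * vcos h) h).trans_lt hfc
    have hA : ∀ g, 0 < f g ↔ g ∈ posA n := by
      intro g
      simp only [posA, Finset.mem_filter, Finset.mem_univ, true_and]
      have h1 := abs_lt.1 (hsup g)
      have h2 := mul_le_mul_of_nonneg_left (hδ1 g) hc.le
      constructor
      · intro hg
        by_contra hcon
        rw [abs_of_nonpos (not_lt.1 hcon)] at h2
        linarith [h1.1, h1.2]
      · intro hg
        rw [abs_of_pos hg] at h2
        linarith [h1.1, h1.2]
    have hT : Tmap f = TA f := by
      funext h
      rw [tmap_filter f (posA n) hA]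
      rfl
    refine ⟨(hA 0).2 (by simp [posA, vcos_zero]), ?_, ?_, ?_⟩
    · intro h hh heq
      have h1 := abs_lt.1 (hsup h)
      have h2 := abs_lt.1 (hsup 0)
      have h3 := mul_le_mul_of_nonneg_left (hδ2 h hh) hc.le
      rw [vcos_zero] at h2
      linarith [h1.1, h1.2, h2.1, h2.2]
    · have : Fact (1 < n) := ⟨by omega⟩
      refine ⟨1, one_ne_zero, (hA 1).2 ?_⟩
      simp only [posA, Finset.mem_filter, Finset.mem_univ, true_and]
      have := vcos_pos_of hn 1 (by simp; omega)
      simpa using this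
    · refine ⟨by rw [hT]; exact sum_TA f hf, lamA n * c, mul_pos lamA_pos hc, ?_⟩
      have h1 : (fun h => Tmap f h - lamA n * c * vcos h) = TA (fun h => f h - c * vcos h) := by
        funext h
        rw [hT, mul_right_comm, ← TA_vcos, mul_comm]
        simp only [TA, Finset.sum_sub_distrib, Finset.mul_sum]
      rw [h1]
      refine (fnorm_TA hn hn5 _ ?_).trans_lt ?_
      · rw [Finset.sum_sub_distrib, ← Finset.mul_sum, hf, sum_vcos hn5]; simp
      · rw [mul_assoc]
        exact mul_lt_mul_of_pos_left hfc lamA_pos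
  obtain ⟨C, hC⟩ := dense_units r e (vcos (n := n)) (sum_vcos hn5)
  have hC0 : 0 ≤ C := by
    obtain ⟨u, hu⟩ := hC 0
    exact (abs_nonneg _).trans (hu 0)
  set t : ℝ := (n * (n * C) + 1) / δ with ht
  have ht0 : 0 < t := by positivity
  obtain ⟨u, hu⟩ := hC t
  have hu0 : ((u : NumberField.RingOfIntegers L) : L) ≠ 0 := by simp
  have hu1 : IsIntegral ℤ ((u : NumberField.RingOfIntegers L) : L) :=
    (u : NumberField.RingOfIntegers L).2
  refine ⟨_, hu0, hu1, ?_, wander r e Q hQ _ hu1 hu0 ⟨sum_lvec r e u, t, ht0, ?_⟩⟩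
  · rw [unit_coe_inv]
    exact (u⁻¹ : (NumberField.RingOfIntegers L)ˣ).val.2
  · refine (fnorm_le _ C hu).trans_lt ?_
    rw [ht, div_mul_cancel₀ _ hδ0.ne']
    linarith

end OddCyclic

set_option linter.unusedSectionVars false

section Groups

/-- Existence of a surjection onto a given group. -/
def HasQuot (A B : Type*) [AddCommGroup A] [AddCommGroup B] : Prop :=
  ∃ f : A →+ B, Function.Surjective f

variable {ι : Type} {n : ι → ℕ}

lemma cast_surj {d m : ℕ} (h : d ∣ m) : Function.Surjective (ZMod.castHom h (ZMod d)) :=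
  ZMod.ringHom_surjective _

lemma quot_one (i : ι) {d : ℕ} (h : d ∣ n i) : HasQuot (∀ i, ZMod (n i)) (ZMod d) := by
  classical
  refine ⟨(ZMod.castHom h (ZMod d)).toAddMonoidHom.comp (Pi.evalAddMonoidHom _ i), fun y => ?_⟩
  obtain ⟨x, hx⟩ := cast_surj h y
  exact ⟨Function.update 0 i x, by simpa using hx⟩

lemma quot_two (i j : ι) (hij : i ≠ j) {d d' : ℕ} (h : d ∣ n i) (h' : d' ∣ n j) :
    HasQuot (∀ i, ZMod (n i)) (ZMod d × ZMod d') := by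
  classical
  refine ⟨((ZMod.castHom h (ZMod d)).toAddMonoidHom.comp (Pi.evalAddMonoidHom _ i)).prod
    ((ZMod.castHom h' (ZMod d')).toAddMonoidHom.comp (Pi.evalAddMonoidHom _ j)), fun y => ?_⟩
  obtain ⟨x, hx⟩ := cast_surj h y.1
  obtain ⟨x', hx'⟩ := cast_surj h' y.2
  refine ⟨Function.update (Function.update 0 j x') i x, ?_⟩
  refine Prod.ext ?_ ?_
  · simpa using hx
  · simpa [Function.update_of_ne hij.symm] using hx'

lemma quot_three (i j k : ι) (hij : i ≠ j) (hik : i ≠ k) (hjk : j ≠ k) {d d' d'' : ℕ}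
    (h : d ∣ n i) (h' : d' ∣ n j) (h'' : d'' ∣ n k) :
    HasQuot (∀ i, ZMod (n i)) (ZMod d × ZMod d' × ZMod d'') := by
  classical
  refine ⟨((ZMod.castHom h (ZMod d)).toAddMonoidHom.comp (Pi.evalAddMonoidHom _ i)).prod
    (((ZMod.castHom h' (ZMod d')).toAddMonoidHom.comp (Pi.evalAddMonoidHom _ j)).prod
    ((ZMod.castHom h'' (ZMod d'')).toAddMonoidHom.comp (Pi.evalAddMonoidHom _ k))), fun y => ?_⟩
  obtain ⟨x, hx⟩ := cast_surj h y.1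
  obtain ⟨x', hx'⟩ := cast_surj h' y.2.1
  obtain ⟨x'', hx''⟩ := cast_surj h'' y.2.2
  refine ⟨Function.update (Function.update (Function.update 0 k x'') j x') i x, ?_⟩
  refine Prod.ext ?_ (Prod.ext ?_ ?_)
  · simpa using hx
  · simpa [Function.update_of_ne hij.symm] using hx'
  · simpa [Function.update_of_ne hik.symm, Function.update_of_ne hjk.symm] using hx''

/-- The list of critical quotients. -/
def BigQuot (A : Type*) [AddCommGroup A] : Prop :=
  (∃ n : ℕ, Odd n ∧ 5 ≤ n ∧ HasQuot A (ZMod n)) ∨ HasQuot A (ZMod 4) ∨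
    HasQuot A (ZMod 2 × ZMod 3) ∨ HasQuot A (ZMod 2 × ZMod 2 × ZMod 2) ∨
    HasQuot A (ZMod 3 × ZMod 3)

lemma HasQuot.congr {A A' B : Type*} [AddCommGroup A] [AddCommGroup A'] [AddCommGroup B]
    (h : HasQuot A B) (e : A' ≃+ A) : HasQuot A' B := by
  obtain ⟨f, hf⟩ := h
  exact ⟨f.comp e.toAddMonoidHom, hf.comp e.surjective⟩

lemma BigQuot.congr {A A' : Type*} [AddCommGroup A] [AddCommGroup A']
    (h : BigQuot A) (e : A' ≃+ A) : BigQuot A' := by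
  rcases h with ⟨n, h1, h2, h3⟩ | h | h | h | h
  · exact Or.inl ⟨n, h1, h2, h3.congr e⟩
  · exact Or.inr (Or.inl (h.congr e))
  · exact Or.inr (Or.inr (Or.inl (h.congr e)))
  · exact Or.inr (Or.inr (Or.inr (Or.inl (h.congr e))))
  · exact Or.inr (Or.inr (Or.inr (Or.inr (h.congr e))))

lemma bigQuot_pi [Fintype ι] (hn : ∀ i, 1 < n i)
    (h : ¬ (Nat.card (∀ i, ZMod (n i)) = 1 ∨ Nat.card (∀ i, ZMod (n i)) = 2 ∨
      Nat.card (∀ i, ZMod (n i)) = 3 ∨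
      (Nat.card (∀ i, ZMod (n i)) = 4 ∧ ∀ g : (∀ i, ZMod (n i)), g + g = 0))) :
    BigQuot (∀ i, ZMod (n i)) := by
  classical
  by_contra hcon
  have h1 : ¬ ∃ n' : ℕ, Odd n' ∧ 5 ≤ n' ∧ HasQuot (∀ i, ZMod (n i)) (ZMod n') :=
    fun h => hcon (Or.inl h)
  have h2 : ¬ HasQuot (∀ i, ZMod (n i)) (ZMod 4) := fun h => hcon (Or.inr (Or.inl h))
  have h3 : ¬ HasQuot (∀ i, ZMod (n i)) (ZMod 2 × ZMod 3) :=
    fun h => hcon (Or.inr (Or.inr (Or.inl h)))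
  have h4 : ¬ HasQuot (∀ i, ZMod (n i)) (ZMod 2 × ZMod 2 × ZMod 2) :=
    fun h => hcon (Or.inr (Or.inr (Or.inr (Or.inl h))))
  have h5 : ¬ HasQuot (∀ i, ZMod (n i)) (ZMod 3 × ZMod 3) :=
    fun h => hcon (Or.inr (Or.inr (Or.inr (Or.inr h))))
  have h23 : ∀ i, n i = 2 ∨ n i = 3 := by
    intro i
    have hi := hn i
    obtain ⟨k, m, hm, hk⟩ := Nat.exists_eq_two_pow_mul_odd (n := n i) (by omega)
    have hm4 : m < 5 := by
      by_contra h
      exact h1 ⟨m, hm, by omega, quot_one i (hk ▸ dvd_mul_left _ _)⟩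
    have hk1 : k < 2 := by
      by_contra h
      refine h2 (quot_one i ?_)
      rw [hk]
      exact Dvd.dvd.mul_right (pow_dvd_pow 2 (by omega : 2 ≤ k)) m
    have h6 : n i ≠ 6 := by
      intro h6
      obtain ⟨f, hf⟩ := quot_one i (dvd_of_eq h6.symm)
      refine h3 ⟨(ZMod.chineseRemainder (by norm_num : Nat.Coprime 2 3)).toAddMonoidHom.comp f, ?_⟩
      exact (ZMod.chineseRemainder (by norm_num : Nat.Coprime 2 3)).surjective.comp hf
    rw [Nat.odd_iff] at hm
    have hk' : k = 0 ∨ k = 1 := by omega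
    have hm' : m = 1 ∨ m = 3 := by omega
    rcases hk' with rfl | rfl <;> rcases hm' with rfl | rfl <;> omega
  have hcard : Nat.card (∀ i, ZMod (n i)) = ∏ i, n i := by
    rw [Nat.card_pi]; simp
  by_cases hall2 : ∀ i, n i = 2
  · have hι : Fintype.card ι ≤ 2 := by
      by_contra hh
      obtain ⟨i, j, k, hij, hik, hjk⟩ := Fintype.two_lt_card_iff.1 (not_le.1 hh)
      exact h4 (quot_three i j k hij hik hjk (by rw [hall2]) (by rw [hall2]) (by rw [hall2]))
    have hc : Nat.card (∀ i, ZMod (n i)) = 2 ^ Fintype.card ι := by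
      rw [hcard]; simp [hall2]
    refine h ?_
    interval_cases hh : Fintype.card ι
    · left; rw [hc]; norm_num
    · right; left; rw [hc]; norm_num
    · right; right; right
      refine ⟨by rw [hc]; norm_num, fun g => ?_⟩
      funext i
      have h7 : ((2 : ℕ) : ZMod (n i)) = 0 := by
        rw [← hall2 i]; simp
      rw [Pi.add_apply, Pi.zero_apply, ← two_mul]
      rw [Nat.cast_ofNat] at h7
      rw [h7, zero_mul]
  · push Not at hall2
    obtain ⟨i0, hi0⟩ := hall2
    have hi3 : n i0 = 3 := (h23 i0).resolve_left hi0
    have hall3 : ∀ i, n i = 3 := by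
      intro i
      refine (h23 i).resolve_left fun hi => h3 (quot_two i i0 ?_ (by rw [hi]) (by rw [hi3]))
      rintro rfl; omega
    have hι : ∀ i, i = i0 := by
      intro i
      by_contra hii
      exact h5 (quot_two i i0 hii (by rw [hall3]) (by rw [hall3]))
    have : Fintype.card ι = 1 := Fintype.card_eq_one_iff.2 ⟨i0, hι⟩
    refine h (Or.inr (Or.inr (Or.inl ?_)))
    rw [hcard]; simp [hall3, this]

lemma bigQuot_of (A : Type*) [AddCommGroup A] [Finite A]
    (h : ¬ (Nat.card A = 1 ∨ Nat.card A = 2 ∨ Nat.card A = 3 ∨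
      (Nat.card A = 4 ∧ ∀ g : A, g + g = 0))) : BigQuot A := by
  classical
  obtain ⟨ι, _, n, hn, ⟨e⟩⟩ := AddCommGroup.equiv_directSum_zmod_of_finite' A
  let e' : A ≃+ (∀ i, ZMod (n i)) := e.trans (DirectSum.addEquivProd _)
  refine BigQuot.congr (bigQuot_pi hn ?_) e'
  rw [← Nat.card_congr e'.toEquiv]
  intro h'
  refine h ?_
  rcases h' with h' | h' | h' | ⟨h', h''⟩
  · exact Or.inl h'
  · exact Or.inr (Or.inl h')
  · exact Or.inr (Or.inr (Or.inl h'))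
  · refine Or.inr (Or.inr (Or.inr ⟨h', fun g => e'.injective ?_⟩))
    rw [map_add, h'', map_zero]

end Groups

section Transfer
variable {L : Type*} [Field L] [NumberField L] [IsGalois ℚ L]

lemma wander_transfer (r : L →+* ℝ) (F : IntermediateField ℚ L)
    (h : WanderUnit (r.comp (algebraMap F L))) : WanderUnit r := by
  obtain ⟨x, h0, h1, h2, h3⟩ := h
  refine ⟨algebraMap F L x, by simpa using h0, h1.algebraMap, ?_, h3⟩
  rw [← map_inv₀]
  exact h2.algebraMap

lemma wander_of_quot (hab : ∀ g h : L ≃ₐ[ℚ] L, g * h = h * g) (r : L →+* ℝ) {H : Type*}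
    [AddCommGroup H] (f : (L ≃ₐ[ℚ] L) →* Multiplicative H) (hf : Function.Surjective f)
    (hw : ∀ (F : IntermediateField ℚ L) (_ : IsGalois ℚ F) (r : F →+* ℝ),
      Multiplicative H ≃* (F ≃ₐ[ℚ] F) → WanderUnit r) : WanderUnit r := by
  let e1 := IsGalois.normalAutEquivQuotient (K := ℚ) (L := L) f.ker
  let e2 := QuotientGroup.quotientKerEquivOfSurjective f hf
  refine wander_transfer r (IntermediateField.fixedField f.ker) ?_
  exact hw _ (IsGalois.of_fixedField_normal_subgroup f.ker) _ (e2.symm.trans e1)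

lemma wander_main (hab : ∀ g h : L ≃ₐ[ℚ] L, g * h = h * g) (r : L →+* ℝ)
    (hG : ¬ (Nat.card (L ≃ₐ[ℚ] L) = 1 ∨ Nat.card (L ≃ₐ[ℚ] L) = 2 ∨ Nat.card (L ≃ₐ[ℚ] L) = 3 ∨
      (Nat.card (L ≃ₐ[ℚ] L) = 4 ∧ ∀ g : L ≃ₐ[ℚ] L, g * g = 1))) : WanderUnit r := by
  let _ : CommGroup (L ≃ₐ[ℚ] L) := { (inferInstance : Group (L ≃ₐ[ℚ] L)) with mul_comm := hab }
  have key := bigQuot_of (Additive (L ≃ₐ[ℚ] L)) (by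
    intro h; exact hG h)
  rcases key with ⟨n, h1, h2, f, hf⟩ | ⟨f, hf⟩ | ⟨f, hf⟩ | ⟨f, hf⟩ | ⟨f, hf⟩
  · have : NeZero n := ⟨by omega⟩
    exact wander_of_quot hab r (AddMonoidHom.toMultiplicativeRight f) hf
      fun F _ r e => wander_odd h1 h2 r e
  · exact wander_of_quot hab r (AddMonoidHom.toMultiplicativeRight f) hf fun F _ r e => wander_C4 r e
  · exact wander_of_quot hab r (AddMonoidHom.toMultiplicativeRight f) hf fun F _ r e => wander_C6 r e
  · exact wander_of_quot hab r (AddMonoidHom.toMultiplicativeRight f) hf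
      fun F _ r e => wander_C222 r e
  · exact wander_of_quot hab r (AddMonoidHom.toMultiplicativeRight f) hf fun F _ r e => wander_C33 r e

end Transfer

set_option linter.unusedSectionVars false

section Final

lemma root_mem (K : IntermediateField ℚ ℂ) [IsGalois ℚ K] (x : K) (y : ℂ)
    (hy : aeval y (minpoly ℚ x) = 0) : y ∈ K := by
  have hx : IsIntegral ℚ x := (IsGalois.to_normal (F := ℚ) (E := K)).isIntegral x
  have hs := (IsGalois.to_normal (F := ℚ) (E := K)).splits x
  have h0 : (minpoly ℚ x).map (algebraMap ℚ K) ≠ 0 := Polynomial.map_ne_zero (minpoly.ne_zero hx)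
  have hr : (((minpoly ℚ x).map (algebraMap ℚ K)).map (algebraMap K ℂ)).IsRoot y := by
    rw [Polynomial.map_map, ← IsScalarTower.algebraMap_eq, IsRoot, eval_map_algebraMap]
    exact hy
  obtain ⟨z, rfl⟩ := hs.mem_range_of_isRoot h0 hr
  exact z.2

lemma minpoly_coe (K : IntermediateField ℚ ℂ) (x : K) : minpoly ℚ (x : ℂ) = minpoly ℚ x :=
  minpoly.algebraMap_eq (algebraMap K ℂ).injective x

/-- The real elements of a field. -/
noncomputable def realSub (K : IntermediateField ℚ ℂ) : IntermediateField ℚ ℂ :=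
  K ⊓ (IsScalarTower.toAlgHom ℚ ℝ ℂ).fieldRange

lemma mem_realSub (K : IntermediateField ℚ ℂ) (z : ℂ) : z ∈ realSub K ↔ z ∈ K ∧ z.im = 0 := by
  unfold realSub
  rw [IntermediateField.mem_inf]
  refine and_congr_right fun _ => ?_
  rw [AlgHom.mem_fieldRange]
  constructor
  · rintro ⟨a, rfl⟩; simp
  · intro h
    exact ⟨z.re, Complex.ext (by simp) (by simp [h])⟩

lemma realSub_real (K : IntermediateField ℚ ℂ) [IsGalois ℚ K]
    (hab : ∀ g h : K ≃ₐ[ℚ] K, g * h = h * g) (φ : realSub K →+* ℂ) (x : realSub K) :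
    (φ x).im = 0 := by
  have hx := (mem_realSub K x).1 x.2
  let x' : K := ⟨x, hx.1⟩
  have hIsInt : IsIntegral ℚ x' := (IsGalois.to_normal (F := ℚ) (E := K)).isIntegral x'
  have hmin : minpoly ℚ x = minpoly ℚ x' := by
    rw [← minpoly_coe, ← minpoly_coe]
  have hroot : aeval (φ x) (minpoly ℚ x') = 0 := by
    rw [← hmin]
    have := minpoly.aeval ℚ x
    have h2 := congrArg φ.toRatAlgHom this
    rw [← Polynomial.aeval_algHom_apply, map_zero] at h2
    exact h2
  have hy := root_mem K x' _ hroot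
  -- complex conjugation on K
  have hconj : ∀ z : K, (starRingEnd ℂ) (z : ℂ) ∈ K := by
    intro z
    refine root_mem K z _ ?_
    let cc : ℂ →ₐ[ℚ] ℂ := (starRingEnd ℂ).toRatAlgHom
    have := minpoly.aeval ℚ z
    have h2 := congrArg (cc.comp K.val) this
    rw [← Polynomial.aeval_algHom_apply, map_zero] at h2
    exact h2
  let c0 : K →+* K := ((starRingEnd ℂ).comp (algebraMap K ℂ)).codRestrict K.toSubfield hconj
  let c1 : K →ₐ[ℚ] K := c0.toRatAlgHom
  have hc0 : ∀ z : K, ((c0 z : K) : ℂ) = (starRingEnd ℂ) (z : ℂ) := fun z => rfl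
  have hcc : ∀ z : K, c1 (c1 z) = z := by
    intro z
    apply Subtype.ext
    change ((c0 (c0 z) : K) : ℂ) = z
    rw [hc0, hc0]; simp
  let c : K ≃ₐ[ℚ] K := AlgEquiv.ofBijective c1
    ⟨c1.injective, fun z => ⟨c1 z, hcc z⟩⟩
  have hc : ∀ z : K, ((c z : K) : ℂ) = (starRingEnd ℂ) (z : ℂ) := fun z => rfl
  obtain ⟨σ, hσ⟩ := minpoly.exists_algEquiv_of_root' (K := ℚ) (L := K) (x := ⟨φ x, hy⟩) (y := x')
    hIsInt.isAlgebraic (by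
      apply (algebraMap K ℂ).injective
      rw [map_zero, ← Polynomial.aeval_algebraMap_apply]
      exact hroot)
  have hcx : c x' = x' := by
    apply Subtype.ext
    rw [hc]
    exact Complex.conj_eq_iff_im.2 hx.2
  have h5 : c (σ x') = σ x' := by
    rw [← AlgEquiv.mul_apply, hab, AlgEquiv.mul_apply, hcx]
  rw [hσ] at h5
  have h6 := congrArg (fun z : K => (z : ℂ)) h5
  simp only [hc] at h6
  exact Complex.conj_eq_iff_im.1 h6

open Classical in
lemma mahler_mem (K : IntermediateField ℚ ℂ) [IsGalois ℚ K] (α : K) :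
    mahlerC (α : ℂ) ∈ realSub K ∧ IsIntegral ℤ (mahlerC (α : ℂ)) ∧ 1 ≤ mahlerM (α : ℂ) := by
  have hIsInt : IsIntegral ℚ α := (IsGalois.to_normal (F := ℚ) (E := K)).isIntegral α
  have hIsIntC : IsIntegral ℚ (α : ℂ) := hIsInt.algebraMap
  set p := intMinpoly (α : ℂ) with hp
  have hp0 : p ≠ 0 := (intMinpoly_primitive (α : ℂ)).ne_zero
  set R := (p.map (Int.castRingHom ℂ)).roots with hR
  set S := R.filter (fun z => 1 < ‖z‖) with hS
  set P : ℂ := (p.leadingCoeff : ℂ) * S.prod with hP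
  have hRK : ∀ z ∈ R, z ∈ K := by
    intro z hz
    rw [hR, hp, intMinpoly_roots _ hIsIntC, mem_aroots, minpoly_coe] at hz
    exact root_mem K α z hz.2
  have hPK : P ∈ K := by
    refine K.mul_mem (intCast_mem K _) ?_
    exact multiset_prod_mem _ fun z hz => hRK z (Multiset.mem_of_mem_filter hz)
  have hRc : R.map (starRingEnd ℂ) = R := by
    rw [hR, ← (IsAlgClosed.splits (p.map (Int.castRingHom ℂ))).roots_map, Polynomial.map_map]
    congr 2
    exact RingHom.ext_int _ _
  have hSc : S.map (starRingEnd ℂ) = S := by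
    conv_rhs => rw [hS, ← hRc, Multiset.filter_map]
    rw [hS]
    congr 1
    refine Multiset.filter_congr fun z _ => ?_
    simp
  have hPc : (starRingEnd ℂ) P = P := by
    rw [hP, map_mul, map_multiset_prod, hSc, map_intCast]
  have hPint : IsIntegral ℤ P := integral_lc_prod p S (Multiset.filter_le _ _)
  have hprod : ∀ T : Multiset ℂ, (T.map (fun z => max 1 ‖z‖)).prod =
      ‖(T.filter (fun z => 1 < ‖z‖)).prod‖ := by
    intro T
    induction T using Multiset.induction with
    | empty => simp
    | cons a T ih =>
      rw [Multiset.map_cons, Multiset.prod_cons, ih]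
      by_cases ha : 1 < ‖a‖
      · rw [Multiset.filter_cons_of_pos (p := fun z : ℂ => 1 < ‖z‖) _ ha, Multiset.prod_cons, norm_mul, max_eq_right ha.le]
      · rw [Multiset.filter_cons_of_neg (p := fun z : ℂ => 1 < ‖z‖) _ ha, max_eq_left (not_lt.1 ha), one_mul]
  have hM : mahlerM (α : ℂ) = ‖P‖ := by
    unfold mahlerM
    rw [hprod, hP, norm_mul]
    congr 1
    rw [Complex.norm_intCast, Nat.cast_natAbs, Int.cast_abs]
  have hPre : P = ((P.re : ℝ) : ℂ) := (Complex.conj_eq_iff_re.1 hPc).symm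
  have hsign : mahlerC (α : ℂ) = P ∨ mahlerC (α : ℂ) = -P := by
    have h1 : mahlerC (α : ℂ) = ((|P.re| : ℝ) : ℂ) := by
      unfold mahlerC
      rw [hM]
      conv_lhs => rw [hPre]
      rw [Complex.norm_real, Real.norm_eq_abs]
    rcases abs_choice P.re with h | h
    · left; rw [h1, h, ← hPre]
    · right; rw [h1, h, Complex.ofReal_neg, ← hPre]
  refine ⟨(mem_realSub K _).2 ⟨?_, by simp [mahlerC]⟩, ?_, ?_⟩
  · rcases hsign with h | h
    · rw [h]; exact hPK
    · rw [h]; exact K.neg_mem hPK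
  · rcases hsign with h | h
    · rw [h]; exact hPint
    · rw [h]; exact hPint.neg
  · unfold mahlerM
    refine one_le_mul_of_one_le_of_one_le ?_ ?_
    · have : p.leadingCoeff.natAbs ≠ 0 := by simpa using hp0
      exact_mod_cast Nat.one_le_iff_ne_zero.2 this
    · refine Multiset.prod_induction (fun y : ℝ => 1 ≤ y) _
        (fun a b ha hb => one_le_mul_of_one_le_of_one_le ha hb) le_rfl ?_
      intro y hy
      obtain ⟨z, -, rfl⟩ := Multiset.mem_map.1 hy
      exact le_max_left _ _

end Final

theorem abelian_field_preperiodic_iff (K : IntermediateField ℚ ℂ)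
    [FiniteDimensional ℚ K] [IsGalois ℚ K]
    (hab : ∀ g h : K ≃ₐ[ℚ] K, g * h = h * g)
    (Kp : IntermediateField ℚ ℂ) (hKpK : Kp ≤ K)
    (hKpreal : ∀ φ : Kp →+* ℂ, ∀ x : Kp, (φ x).im = 0)
    (hKpmax : ∀ F : IntermediateField ℚ ℂ, F ≤ K →
      (∀ φ : F →+* ℂ, ∀ x : F, (φ x).im = 0) → F ≤ Kp) :
    ((∀ α : K, (Set.range fun m : ℕ => mahlerC^[m] (α : ℂ)).Finite) ↔
      (Module.finrank ℚ Kp = 1 ∨ Module.finrank ℚ Kp = 2 ∨ Module.finrank ℚ Kp = 3 ∨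
        (Module.finrank ℚ Kp = 4 ∧ ∀ g : Kp ≃ₐ[ℚ] Kp, g * g = 1))) ∧
    (¬(Module.finrank ℚ Kp = 1 ∨ Module.finrank ℚ Kp = 2 ∨ Module.finrank ℚ Kp = 3 ∨
        (Module.finrank ℚ Kp = 4 ∧ ∀ g : Kp ≃ₐ[ℚ] Kp, g * g = 1)) →
      ∃ α : K, (α : ℂ) ≠ 0 ∧ IsIntegral ℤ (α : ℂ) ∧ IsIntegral ℤ ((α : ℂ))⁻¹ ∧
        (Set.range fun m : ℕ => mahlerC^[m] (α : ℂ)).Infinite) := by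
  have hKab : IsAbelianGalois ℚ K := { is_comm := ⟨hab⟩ }
  have hKpab : IsAbelianGalois ℚ Kp :=
    @IsAbelianGalois.of_algHom ℚ Kp K _ _ _ _ _ (IntermediateField.inclusion hKpK) hKab
  have hKpG : IsGalois ℚ Kp := hKpab.toIsGalois
  have hfin : FiniteDimensional ℚ Kp :=
    FiniteDimensional.of_injective (IntermediateField.inclusion hKpK).toLinearMap
      (IntermediateField.inclusion hKpK).injective
  have hNF : NumberField Kp := { to_charZero := inferInstance, to_finiteDimensional := hfin }
  have habp : ∀ g h : Kp ≃ₐ[ℚ] Kp, g * h = h * g := hKpab.toIsMulCommutative.is_comm.comm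
  have hre : ∀ x : Kp, (x : ℂ) = (((x : ℂ).re : ℝ) : ℂ) := fun x =>
    Complex.ext (by simp) (by simpa using hKpreal (algebraMap Kp ℂ) x)
  let r : Kp →+* ℝ :=
    { toFun := fun x => (x : ℂ).re
      map_one' := by simp
      map_zero' := by simp
      map_add' := fun x y => by simp
      map_mul' := fun x y => by
        have h1 : (x : ℂ).im = 0 := hKpreal (algebraMap Kp ℂ) x
        simp [h1] }
  have hr : ∀ x : Kp, ((r x : ℝ) : ℂ) = (x : ℂ) := fun x => (hre x).symm
  have hle : realSub K ≤ Kp := hKpmax _ inf_le_left (realSub_real K hab)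
  rw [← IsGalois.card_aut_eq_finrank ℚ Kp]
  have hpart2 : ¬(Nat.card (Kp ≃ₐ[ℚ] Kp) = 1 ∨ Nat.card (Kp ≃ₐ[ℚ] Kp) = 2 ∨
      Nat.card (Kp ≃ₐ[ℚ] Kp) = 3 ∨
        (Nat.card (Kp ≃ₐ[ℚ] Kp) = 4 ∧ ∀ g : Kp ≃ₐ[ℚ] Kp, g * g = 1)) →
      ∃ α : K, (α : ℂ) ≠ 0 ∧ IsIntegral ℤ (α : ℂ) ∧ IsIntegral ℤ ((α : ℂ))⁻¹ ∧
        (Set.range fun m : ℕ => mahlerC^[m] (α : ℂ)).Infinite := by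
    intro h
    obtain ⟨x, h0, h1, h2, h3⟩ := wander_main habp r h
    refine ⟨⟨x, hKpK x.2⟩, ?_, ?_, ?_, ?_⟩
    · simpa using h0
    · exact h1.algebraMap (B := ℂ)
    · have := h2.algebraMap (B := ℂ)
      rw [map_inv₀] at this
      exact this
    · rw [hr] at h3
      exact h3
  refine ⟨⟨fun h => ?_, fun h α => ?_⟩, hpart2⟩
  · by_contra hcon
    obtain ⟨α, -, -, -, hα⟩ := hpart2 hcon
    exact hα (h α)
  · obtain ⟨h1, h2, h3⟩ := mahler_mem K α
    let x : Kp := ⟨mahlerC (α : ℂ), hle h1⟩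
    have hx : IsIntegral ℤ x := by
      have : IsIntegral ℤ (algebraMap Kp ℂ x) := h2
      exact (isIntegral_algebraMap_iff (algebraMap Kp ℂ).injective).1 this
    have hrx : r x = mahlerM (α : ℂ) := by
      change (mahlerC (α : ℂ)).re = _
      simp [mahlerC]
    have h4 := prePer_small r h x hx (by rw [hrx]; exact h3)
    rw [hr] at h4
    exact PrePer.of_next h4
end
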